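/- arXiv:math/0304051 — 4 statements merged into one kernel-verified Lean document; each statement's English description precedes it below -/
import Mathlib

section
/- Let (R, 𝔪) be an excellent Noetherian local domain of prime characteristic p > 0 with residue field k = R/𝔪, and suppose the Krull dimension of R is at most 2. If Tor_1^R(R^+, k) = 0, then R is a regular local ring. -/
set_option synthInstance.maxHeartbeats 1000000
set_option maxHeartbeats 1000000
set_option linter.unusedVariables false

open CategoryTheory

/-- `Tor_n^R(M, N)`, the `n`-th Tor group of the `R`-modules `M` and `N`. -/
noncomputable abbrev TorGrp (R : Type) [CommRing R] (n : ℕ)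
    (M N : Type) [AddCommGroup M] [Module R M] [AddCommGroup N] [Module R N] : Type :=
  ((Tor (ModuleCat R) n).obj (ModuleCat.of R M)).obj (ModuleCat.of R N)

/-- The absolute integral closure `R⁺` of a domain `R`: the integral closure of `R`
in an algebraic closure of its fraction field. -/
noncomputable abbrev AbsIntClo (R : Type) [CommRing R] [IsDomain R] : Type :=
  integralClosure R (AlgebraicClosure (FractionRing R))

/-- A regular local ring: a Noetherian local ring whose maximal ideal can be generated
by Krull-dimension many elements. -/
def IsRegularLocalRingP (A : Type) [CommRing A] : Prop :=
  IsNoetherianRing A ∧ ∃ h : IsLocalRing A, ∃ s : Finset A,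
    Ideal.span (s : Set A) = @IsLocalRing.maximalIdeal A _ h ∧
      (s.card : WithBot ℕ∞) = ringKrullDim A

/-- A regular ring: a Noetherian ring all of whose localizations at primes are
regular local rings. -/
def IsRegularRingP (A : Type) [CommRing A] : Prop :=
  IsNoetherianRing A ∧
    ∀ (p : Ideal A) (hp : p.IsPrime),
      haveI := hp
      IsRegularLocalRingP (Localization.AtPrime p)

/-- A chain of primes is saturated if each step is a covering relation. -/
def IsSaturatedChain {α : Type} [Preorder α] (c : LTSeries α) : Prop :=
  ∀ i : Fin c.length, c.toFun i.castSucc ⋖ c.toFun i.succ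

/-- A ring is catenary if any two saturated chains of primes with the same endpoints
have the same length. -/
def IsCatenaryRing (A : Type) [CommRing A] : Prop :=
  ∀ c₁ c₂ : LTSeries (PrimeSpectrum A),
    c₁.head = c₂.head → c₁.last = c₂.last →
      IsSaturatedChain c₁ → IsSaturatedChain c₂ → c₁.length = c₂.length

/-- A ring is universally catenary if every finitely generated algebra over it
(i.e. every quotient of a polynomial ring over it) is catenary. -/
def IsUniversallyCatenary (A : Type) [CommRing A] : Prop :=
  ∀ (n : ℕ) (I : Ideal (MvPolynomial (Fin n) A)),
    IsCatenaryRing (MvPolynomial (Fin n) A ⧸ I)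

/-- A `κ`-algebra `B` is geometrically regular if `L ⊗_κ B` is a regular ring for
every finite field extension `L` of `κ`. -/
def IsGeometricallyRegularAlgebra (κ : Type) [Field κ] (B : Type) [CommRing B]
    [Algebra κ B] : Prop :=
  ∀ (L : Type) (_ : Field L) (_ : Algebra κ L) (_ : Module.Finite κ L),
    IsRegularRingP (TensorProduct κ L B)

/-- A ring `A` is a G-ring if for every prime `p` of `A`, all fibers of the completion
map `A_p → (A_p)^∧` are geometrically regular; the fiber at a prime `q` of `A_p` is
`κ(q) ⊗_{A_p} (A_p)^∧`. -/
def IsGRing (A : Type) [CommRing A] : Prop :=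
  ∀ (p : Ideal A) (hp : p.IsPrime),
    haveI := hp
    ∀ (q : Ideal (Localization.AtPrime p)) (hq : q.IsPrime),
      haveI := hq
      IsGeometricallyRegularAlgebra
        (IsLocalRing.ResidueField (Localization.AtPrime q))
        (TensorProduct (Localization.AtPrime p)
          (IsLocalRing.ResidueField (Localization.AtPrime q))
          (AdicCompletion (IsLocalRing.maximalIdeal (Localization.AtPrime p))
            (Localization.AtPrime p)))

/-- A ring `A` is J-2 if the regular locus of every finitely generated `A`-algebra
is open in its prime spectrum. -/
def IsJ2 (A : Type) [CommRing A] : Prop :=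
  ∀ (n : ℕ) (I : Ideal (MvPolynomial (Fin n) A)),
    IsOpen {p : PrimeSpectrum (MvPolynomial (Fin n) A ⧸ I) |
      IsRegularLocalRingP (Localization.AtPrime p.asIdeal)}

/-- A ring is excellent if it is Noetherian, universally catenary, a G-ring, and J-2. -/
def IsExcellentRing (A : Type) [CommRing A] : Prop :=
  IsNoetherianRing A ∧ IsUniversallyCatenary A ∧ IsGRing A ∧ IsJ2 A

/-- A list of elements of a local ring is a system of parameters if its elements lie in
the maximal ideal, its length is the Krull dimension, and the ideal it generates has
radical the maximal ideal (i.e. is primary to the maximal ideal). -/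
def IsSystemOfParameters (R : Type) [CommRing R] [IsLocalRing R] (rs : List R) : Prop :=
  (∀ x ∈ rs, x ∈ IsLocalRing.maximalIdeal R) ∧
    (rs.length : WithBot ℕ∞) = ringKrullDim R ∧
    (Ideal.ofList rs).radical = IsLocalRing.maximalIdeal R

/-- A local ring is Cohen-Macaulay if it is Noetherian and admits a regular sequence of
length equal to its Krull dimension consisting of elements of the maximal ideal. -/
def IsCohenMacaulayLocalRing (R : Type) [CommRing R] : Prop :=
  IsNoetherianRing R ∧ ∃ h : IsLocalRing R,
    ∃ rs : List R, (∀ x ∈ rs, x ∈ @IsLocalRing.maximalIdeal R _ h) ∧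
      RingTheory.Sequence.IsRegular R rs ∧ (rs.length : WithBot ℕ∞) = ringKrullDim R

/-- An `R`-algebra `S` is a big Cohen-Macaulay `R`-algebra if some system of parameters
of `R` is an `S`-regular sequence. -/
def IsBigCohenMacaulayAlgebra (R : Type) [CommRing R] [IsLocalRing R]
    (S : Type) [CommRing S] [Algebra R S] : Prop :=
  ∃ rs : List R, IsSystemOfParameters R rs ∧ RingTheory.Sequence.IsRegular S rs
section TensorInjectivity

open TensorProduct

/-- If `K + φ(F) = P`, then injectivity of `M ⊗ φ⁻¹(K) → M ⊗ F` implies injectivity of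
`M ⊗ K → M ⊗ P`. -/
lemma lTensor_subtype_injective_of_comap {R M F P : Type*} [CommRing R]
    [AddCommGroup M] [Module R M] [AddCommGroup F] [Module R F] [AddCommGroup P] [Module R P]
    (K : Submodule R P) (φ : F →ₗ[R] P) (hsup : K ⊔ LinearMap.range φ = ⊤)
    (h : Function.Injective ((K.comap φ).subtype.lTensor M)) :
    Function.Injective (K.subtype.lTensor M) := by
  rw [injective_iff_map_eq_zero] at h ⊢
  intro u hu
  let i : K.comap φ →ₗ[R] K × F :=
    ((φ.comp (K.comap φ).subtype).codRestrict K fun x ↦ x.2).prod (-(K.comap φ).subtype)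
  let g : K × F →ₗ[R] P := K.subtype.coprod φ
  have hg : Function.Surjective g := by
    rw [← LinearMap.range_eq_top, LinearMap.range_coprod, Submodule.range_subtype, hsup]
  have hig : Function.Exact i g := by
    rintro ⟨k, f⟩
    constructor
    · intro hkf
      have hkf' : (k : P) + φ f = 0 := by simpa [g] using hkf
      refine ⟨⟨-f, ?_⟩, ?_⟩
      · rw [Submodule.mem_comap, map_neg, ← eq_neg_of_add_eq_zero_left hkf']
        exact k.2
      · ext
        · exact (map_neg φ f).trans (eq_neg_of_add_eq_zero_left hkf').symm
        · simp [i]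
    · rintro ⟨x, hx⟩
      rw [← hx]
      exact (congrArg (φ x.1 + ·) (map_neg φ x.1)).trans (add_neg_cancel _)
  have hgu : g.lTensor M ((LinearMap.inl R K F).lTensor M u) = 0 := by
    rw [← LinearMap.lTensor_comp_apply, LinearMap.coprod_inl, hu]
  obtain ⟨w, hw⟩ := (lTensor_exact M hig hg _).mp hgu
  have hw0 : w = 0 := by
    apply h
    have := congrArg ((LinearMap.snd R K F).lTensor M) hw
    rw [← LinearMap.lTensor_comp_apply, ← LinearMap.lTensor_comp_apply, LinearMap.snd_comp_inl,
      LinearMap.snd_prod, LinearMap.lTensor_neg, LinearMap.lTensor_zero] at this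
    simpa using this
  have := congrArg ((LinearMap.fst R K F).lTensor M) hw
  rw [hw0, map_zero, map_zero, ← LinearMap.lTensor_comp_apply, LinearMap.fst_comp_inl] at this
  simpa using this.symm

/-- If `C → B → A → k → 0` is exact and `M ⊗ C → M ⊗ B → M ⊗ A` is exact, then
`M ⊗ ker (A → k) → M ⊗ A` is injective. -/
lemma lTensor_subtype_ker_injective_of_exact {R M A B C k : Type*} [CommRing R]
    [AddCommGroup M] [Module R M] [AddCommGroup A] [Module R A] [AddCommGroup B] [Module R B]
    [AddCommGroup C] [Module R C] [AddCommGroup k] [Module R k]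
    (d₂ : C →ₗ[R] B) (d₁ : B →ₗ[R] A) (π : A →ₗ[R] k) (hd : d₁.comp d₂ = 0)
    (hπ : Function.Exact d₁ π) (h : Function.Exact (d₂.lTensor M) (d₁.lTensor M)) :
    Function.Injective ((LinearMap.ker π).subtype.lTensor M) := by
  rw [injective_iff_map_eq_zero]
  intro u hu
  let d : B →ₗ[R] LinearMap.ker π := d₁.codRestrict _ fun b ↦ hπ.apply_apply_eq_zero b
  have hdsurj : Function.Surjective d := by
    rintro ⟨a, ha⟩
    obtain ⟨b, hb⟩ := (hπ a).mp ha
    exact ⟨b, Subtype.ext hb⟩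
  have hdd : d.comp d₂ = 0 := by
    ext x
    exact LinearMap.congr_fun hd x
  obtain ⟨v, rfl⟩ := LinearMap.lTensor_surjective M hdsurj u
  rw [← LinearMap.lTensor_comp_apply] at hu
  obtain ⟨w, rfl⟩ := (h v).mp hu
  rw [← LinearMap.lTensor_comp_apply, hdd]
  simp

lemma lTensor_maximalIdeal_injective_of_tor_one (R M : Type) [CommRing R] [IsLocalRing R]
    [AddCommGroup M] [Module R M]
    (h : Subsingleton (TorGrp R 1 M (IsLocalRing.ResidueField R))) :
    Function.Injective ((IsLocalRing.maximalIdeal R).subtype.lTensor M) := by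
  let k := ModuleCat.of R (IsLocalRing.ResidueField R)
  let P := projectiveResolution k
  let F := (MonoidalCategory.tensoringLeft (ModuleCat R)).obj (ModuleCat.of R M)
  let π : P.complex.X 0 →ₗ[R] IsLocalRing.ResidueField R := (P.π.f 0).hom
  have hzero : Limits.IsZero
      (((F.mapHomologicalComplex (ComplexShape.down ℕ)).obj P.complex).homology 1) := by
    have h1 : Limits.IsZero ((F.leftDerived 1).obj k) := ModuleCat.isZero_of_iff_subsingleton.mpr h
    exact h1.of_iso (P.isoLeftDerivedObj F 1).symm
  have hex := (HomologicalComplex.exactAt_iff_isZero_homology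
    ((F.mapHomologicalComplex (ComplexShape.down ℕ)).obj P.complex) 1).mpr hzero
  rw [HomologicalComplex.exactAt_iff' _ 2 1 0 (by simp) (by simp)] at hex
  have hexact : Function.Exact ((P.complex.d 2 1).hom.lTensor M)
      ((P.complex.d 1 0).hom.lTensor M) :=
    (ShortComplex.ShortExact.moduleCat_exact_iff_function_exact _).mp hex
  have hπ : Function.Exact (P.complex.d 1 0).hom π :=
    (ShortComplex.ShortExact.moduleCat_exact_iff_function_exact _).mp P.exact₀
  have hπs : Function.Surjective π := (ModuleCat.epi_iff_surjective _).mp inferInstance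
  have hker := lTensor_subtype_ker_injective_of_exact (M := M) _ _ π
    (by rw [← ModuleCat.hom_comp, P.complex.d_comp_d]; rfl) hπ hexact
  have : Module.Projective R (P.complex.X 0) := by
    exact (IsProjective.iff_projective _).mpr (P.projective 0)
  obtain ⟨φ, hφ⟩ := Module.projective_lifting_property
    (Algebra.linearMap R (IsLocalRing.ResidueField R)) π IsLocalRing.residue_surjective
  have hπφ (x) : π x = IsLocalRing.residue R (φ x) := (LinearMap.congr_fun hφ x).symm
  have hcomap : Submodule.comap φ (IsLocalRing.maximalIdeal R) = LinearMap.ker π := by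
    ext x
    rw [LinearMap.mem_ker, hπφ, IsLocalRing.residue_eq_zero_iff, Submodule.mem_comap]
  refine lTensor_subtype_injective_of_comap _ φ ?_ (hcomap ▸ hker)
  obtain ⟨x, hx⟩ := hπs 1
  rw [← Ideal.isMaximal_def.mp (IsLocalRing.maximalIdeal.isMaximal R) |>.lt_iff, left_lt_sup]
  intro hle
  have hmem := hle (LinearMap.mem_range_self φ x)
  rw [← IsLocalRing.residue_eq_zero_iff, ← hπφ, hx] at hmem
  exact one_ne_zero hmem

end TensorInjectivity

section PrimaryIdeals

open TensorProduct IsLocalRing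

variable {R : Type*} [CommRing R] [IsLocalRing R]

/-- An ideal `I ≠ R` containing a power of the maximal ideal has a nonzero socle modulo `I`. -/
lemma exists_notMem_maximalIdeal_mul_mem {I : Ideal R} (hI : I ≠ ⊤) {N : ℕ}
    (hN : maximalIdeal R ^ N ≤ I) :
    ∃ x ∉ I, ∀ a ∈ maximalIdeal R, a * x ∈ I := by
  classical
  have hex : ∃ N, maximalIdeal R ^ N ≤ I := ⟨N, hN⟩
  obtain ⟨n, hn⟩ : ∃ n, Nat.find hex = n + 1 := by
    apply Nat.exists_eq_succ_of_ne_zero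
    intro h0
    have := Nat.find_spec hex
    rw [h0, pow_zero, Ideal.one_eq_top, top_le_iff] at this
    exact hI this
  have hnot : ¬ maximalIdeal R ^ n ≤ I := Nat.find_min hex (by omega)
  obtain ⟨x, hx, hxI⟩ := SetLike.not_le_iff_exists.mp hnot
  refine ⟨x, hxI, fun a ha ↦ ?_⟩
  have := Nat.find_spec hex
  rw [hn, pow_succ'] at this
  exact this (Ideal.mul_mem_mul ha hx)

lemma lTensor_subtype_injective_of_pow_le [IsNoetherianRing R] {M : Type*} [AddCommGroup M]
    [Module R M] (h : Function.Injective ((maximalIdeal R).subtype.lTensor M)) (N : ℕ)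
    (I : Ideal R) (hN : maximalIdeal R ^ N ≤ I) :
    Function.Injective (I.subtype.lTensor M) := by
  refine IsNoetherian.induction (R := R) (M := R) (P := fun I ↦ maximalIdeal R ^ N ≤ I →
    Function.Injective (I.subtype.lTensor M)) (fun I ih hN ↦ ?_) I hN
  by_cases hI : I = ⊤
  · subst hI
    exact (LinearEquiv.lTensor M Submodule.topEquiv).injective
  obtain ⟨x, hxI, hx⟩ := exists_notMem_maximalIdeal_mul_mem hI hN
  let J := I ⊔ Ideal.span {x}
  have hIJ : I ≤ J := le_sup_left
  have hxJ : x ∈ J := Ideal.mem_sup_right (Ideal.mem_span_singleton_self x)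
  have hlt : I < J := lt_of_le_of_ne hIJ fun h ↦ hxI (h ▸ hxJ)
  have hJ := ih J hlt (hN.trans hIJ)
  let K : Submodule R J := Submodule.comap J.subtype I
  let φ : R →ₗ[R] J := LinearMap.toSpanSingleton R J ⟨x, hxJ⟩
  have hcomap : Submodule.comap φ K = maximalIdeal R := by
    refine le_antisymm (le_maximalIdeal fun htop ↦ hxI ?_) hx
    have h1 : (1 : R) ∈ Submodule.comap φ K := htop ▸ Submodule.mem_top
    have h1' : (1 : R) * x ∈ I := h1
    rwa [one_mul] at h1'
  have hsup : K ⊔ LinearMap.range φ = ⊤ := by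
    rw [eq_top_iff]
    rintro ⟨y, hy⟩ -
    obtain ⟨a, ha, b, hb, rfl⟩ := Submodule.mem_sup.mp hy
    obtain ⟨c, rfl⟩ := Ideal.mem_span_singleton'.mp hb
    exact Submodule.mem_sup.mpr ⟨⟨a, hIJ ha⟩, ha, φ c, ⟨c, rfl⟩, rfl⟩
  have hK : Function.Injective (K.subtype.lTensor M) :=
    lTensor_subtype_injective_of_comap K φ hsup (hcomap ▸ h)
  have hcomp : I.subtype = J.subtype ∘ₗ K.subtype ∘ₗ
      (Submodule.comapSubtypeEquivOfLe hIJ).symm.toLinearMap := by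
    ext; rfl
  rw [hcomp, LinearMap.lTensor_comp, LinearMap.lTensor_comp]
  exact hJ.comp (hK.comp (LinearEquiv.lTensor M _).injective)

variable {S : Type*} [CommRing S] [Algebra R S]

/-- If `I ⊗ S → S` is injective, every `S`-linear relation between generators of `I` is a
combination of `R`-linear relations. -/
lemma vanishesTrivially_of_sum_mul_algebraMap_eq_zero {R S ι : Type*} [CommRing R] [CommRing S]
    [Algebra R S] [Fintype ι] {a : ι → R} {I : Ideal R} (ha : Ideal.span (Set.range a) = I)
    (h : Function.Injective (I.subtype.lTensor S)) {s : ι → S}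
    (hs : ∑ i, s i * algebraMap R S (a i) = 0) : VanishesTrivially R a s := by
  subst ha
  apply vanishesTrivially_of_sum_tmul_eq_zero_of_rTensor_injective
  · exact (LinearMap.lTensor_inj_iff_rTensor_inj S _).mp h
  · apply (TensorProduct.lid R S).injective
    simpa [Algebra.smul_def, mul_comm] using hs

/-- An `𝔪`-primary ideal is contracted from `S` if `𝔪 ⊗ S → S` is injective and `𝔪 S ≠ S`. -/
lemma mem_of_algebraMap_mem_map [IsNoetherianRing R]
    (h : Function.Injective ((maximalIdeal R).subtype.lTensor S))
    (hS : (maximalIdeal R).map (algebraMap R S) ≠ ⊤) {N : ℕ} {I : Ideal R}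
    (hN : maximalIdeal R ^ N ≤ I) {r : R} (hr : algebraMap R S r ∈ I.map (algebraMap R S)) :
    r ∈ I := by
  by_contra hrI
  obtain ⟨n, a, rfl⟩ := Submodule.fg_iff_exists_fin_generating_family.mp
    (IsNoetherian.noetherian I)
  change algebraMap R S r ∈ (Ideal.span (Set.range a)).map _ at hr
  rw [Ideal.map_span, ← Set.range_comp, Ideal.mem_span_range_iff_exists_fun] at hr
  obtain ⟨s, hs⟩ := hr
  let b : Option (Fin n) → R := fun o ↦ o.elim r a
  let t : Option (Fin n) → S := fun o ↦ o.elim (-1) s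
  have hle : Submodule.span R (Set.range a) ≤ Ideal.span (Set.range b) :=
    Submodule.span_mono (by rintro _ ⟨i, rfl⟩; exact ⟨some i, rfl⟩)
  have hsum : ∑ o, t o * algebraMap R S (b o) = 0 := by
    rw [Fintype.sum_option]
    simpa [t, b, neg_add_eq_zero] using hs.symm
  obtain ⟨k, c, y, hy, hc⟩ := vanishesTrivially_of_sum_mul_algebraMap_eq_zero rfl
    (lTensor_subtype_injective_of_pow_le h N _ (hN.trans hle)) hsum
  have hc0 (j : Fin k) : c none j ∈ maximalIdeal R := by
    intro hu
    have hj := hc j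
    rw [Fintype.sum_option, ← eq_neg_iff_add_eq_zero] at hj
    apply hrI
    rw [← Submodule.smul_mem_iff_of_isUnit _ hu]
    change c none j • b none ∈ _
    rw [hj]
    exact neg_mem (Submodule.sum_mem _ fun i _ ↦
      Submodule.smul_mem _ _ (Submodule.subset_span ⟨i, rfl⟩))
  apply hS
  rw [Ideal.eq_top_iff_one, ← neg_mem_iff]
  change t none ∈ _
  rw [hy]
  refine Ideal.sum_mem _ fun j _ ↦ ?_
  rw [Algebra.smul_def]
  exact Ideal.mul_mem_right _ _ (Ideal.mem_map_of_mem _ (hc0 j))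

/-- If `𝔪 ⊗ S → S` is injective, every `S`-linear relation between minimal generators of `𝔪`
has coefficients in `𝔪 S`. -/
lemma mem_map_maximalIdeal_of_sum_eq_zero {ι : Type*} [Fintype ι]
    (h : Function.Injective ((maximalIdeal R).subtype.lTensor S))
    {a : ι → R} (ha : Ideal.span (Set.range a) = maximalIdeal R)
    (hmin : ∀ r : ι → R, ∑ i, r i * a i = 0 → ∀ i, r i ∈ maximalIdeal R)
    {s : ι → S} (hs : ∑ i, s i * algebraMap R S (a i) = 0) (i : ι) :
    s i ∈ (maximalIdeal R).map (algebraMap R S) := by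
  obtain ⟨k, c, y, hy, hc⟩ := vanishesTrivially_of_sum_mul_algebraMap_eq_zero ha h hs
  rw [hy]
  refine Ideal.sum_mem _ fun j _ ↦ ?_
  rw [Algebra.smul_def]
  refine Ideal.mul_mem_right _ _ (Ideal.mem_map_of_mem _ (hmin (fun i ↦ c i j) ?_ i))
  simpa using hc j

/-- The Frobenius power of `mem_map_maximalIdeal_of_sum_eq_zero`, for a perfect reduced `S`. -/
lemma mem_span_pow_of_sum_eq_zero {ι : Type*} [Fintype ι] [IsReduced S] {p : ℕ} [ExpChar S p]
    (hperf : ∀ x : S, ∃ y, y ^ p = x)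
    (h : Function.Injective ((maximalIdeal R).subtype.lTensor S))
    {a : ι → R} (ha : Ideal.span (Set.range a) = maximalIdeal R)
    (hmin : ∀ r : ι → R, ∑ i, r i * a i = 0 → ∀ i, r i ∈ maximalIdeal R) (e : ℕ)
    {s : ι → S} (hs : ∑ i, s i * algebraMap R S (a i ^ p ^ e) = 0) (i : ι) :
    s i ∈ (Ideal.span (Set.range fun j ↦ a j ^ p ^ e)).map (algebraMap R S) := by
  have hroot : ∀ e : ℕ, ∀ x : S, ∃ y, y ^ p ^ e = x := by
    intro e
    induction e with
    | zero => exact fun x ↦ ⟨x, by simp⟩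
    | succ e ih =>
      intro x
      obtain ⟨y, rfl⟩ := hperf x
      obtain ⟨z, rfl⟩ := ih y
      exact ⟨z, by rw [pow_succ, pow_mul]⟩
  choose t ht using fun i ↦ hroot e (s i)
  have htsum : ∑ i, t i * algebraMap R S (a i) = 0 := by
    have hpow : (∑ i, t i * algebraMap R S (a i)) ^ p ^ e = 0 := by
      rw [sum_pow_char_pow, ← hs]
      simp [mul_pow, ht]
    exact pow_eq_zero_iff (pow_ne_zero _ (expChar_pos S p).ne') |>.mp hpow
  have hti := mem_map_maximalIdeal_of_sum_eq_zero h ha hmin htsum i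
  rw [← ha, Ideal.map_span, ← Set.range_comp, Ideal.mem_span_range_iff_exists_fun] at hti
  obtain ⟨c, hc⟩ := hti
  rw [← ht i, ← hc, sum_pow_char_pow]
  refine Ideal.sum_mem _ fun j _ ↦ ?_
  rw [mul_pow, Function.comp_apply, ← map_pow]
  exact Ideal.mul_mem_left _ _ (Ideal.mem_map_of_mem _ (Ideal.subset_span ⟨j, rfl⟩))

end PrimaryIdeals

section LechIndependence

/-- Elements are Lech independent if the coefficients of every relation between them lie in the
ideal they generate. -/
def IsLechIndependent {R ι : Type*} [CommRing R] [Fintype ι] (v : ι → R) : Prop :=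
  ∀ s : ι → R, ∑ i, s i * v i = 0 → ∀ i, s i ∈ Ideal.span (Set.range v)

variable {R : Type*} [CommRing R]

/-- Additivity of length along `0 → R/(I : f) → R/I → R/(I + f) → 0`. -/
lemma length_quotient_eq_colon_add (I : Ideal R) (f : R) :
    Module.length R (R ⧸ I) =
      Module.length R (R ⧸ (Submodule.comap (LinearMap.toSpanSingleton R R f) I : Ideal R)) +
        Module.length R (R ⧸ (I ⊔ Ideal.span {f})) := by
  set C : Ideal R := Submodule.comap (LinearMap.toSpanSingleton R R f) I with hC
  have hID : I ≤ I ⊔ Ideal.span {f} := le_sup_left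
  have hker : C = LinearMap.ker (I.mkQ ∘ₗ LinearMap.toSpanSingleton R R f) := by
    rw [LinearMap.ker_comp, Submodule.ker_mkQ]
  refine Module.length_eq_add_of_exact
    (C.liftQ (I.mkQ ∘ₗ LinearMap.toSpanSingleton R R f) hker.le)
    (Submodule.factor hID) ?_ (Submodule.factor_surjective hID) ?_
  · exact LinearMap.ker_eq_bot.mp (Submodule.ker_liftQ_eq_bot' _ _ hker)
  · intro y
    obtain ⟨y, rfl⟩ := I.mkQ_surjective y
    have hy : Submodule.factor hID (I.mkQ y) = 0 ↔ y ∈ I ⊔ Ideal.span {f} :=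
      Submodule.Quotient.mk_eq_zero _
    rw [hy]
    constructor
    · intro hy
      obtain ⟨a, ha, b, hb, rfl⟩ := Submodule.mem_sup.mp hy
      obtain ⟨c, rfl⟩ := Ideal.mem_span_singleton'.mp hb
      exact ⟨C.mkQ c, (Submodule.Quotient.eq I).mpr (by simpa using ha)⟩
    · rintro ⟨z, hz⟩
      obtain ⟨c, rfl⟩ := C.mkQ_surjective z
      have hmem : c * f - y ∈ I := (Submodule.Quotient.eq I).mp hz
      rw [← sub_sub_cancel (c * f) y]
      exact sub_mem (Ideal.mem_sup_right (Ideal.mul_mem_left _ _ (Ideal.mem_span_singleton_self f)))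
        (Ideal.mem_sup_left hmem)

lemma length_quotient_anti {I J : Ideal R} (h : I ≤ J) :
    Module.length R (R ⧸ J) ≤ Module.length R (R ⧸ I) :=
  Module.length_le_of_surjective (Submodule.factor h) (Submodule.factor_surjective h)

lemma length_quotient_sup_span_pow_le (J : Ideal R) (f : R) (t : ℕ) :
    Module.length R (R ⧸ (J ⊔ Ideal.span {f ^ t})) ≤
      t * Module.length R (R ⧸ (J ⊔ Ideal.span {f})) := by
  induction t with
  | zero => simp [Submodule.Quotient.subsingleton_iff]
  | succ t ih =>
    rw [length_quotient_eq_colon_add _ f, Nat.cast_succ, add_mul, one_mul]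
    refine add_le_add ((length_quotient_anti ?_).trans ih) (length_quotient_anti ?_)
    · rw [sup_le_iff, Ideal.span_singleton_le_iff_mem]
      refine ⟨fun x hx ↦ Ideal.mem_sup_left (Ideal.mul_mem_right _ _ hx), ?_⟩
      exact Ideal.mem_sup_right (Ideal.mem_span_singleton.mpr (dvd_of_eq (pow_succ f t)))
    · exact sup_le_sup_right le_sup_left _

lemma length_quotient_sup_span_image_pow_le [DecidableEq R] (J : Ideal R) (s : Finset R) (t : ℕ) :
    Module.length R (R ⧸ (J ⊔ Ideal.span (s.image (· ^ t) : Set R))) ≤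
      (t ^ s.card : ℕ) * Module.length R (R ⧸ (J ⊔ Ideal.span (s : Set R))) := by
  induction s using Finset.induction_on generalizing J with
  | empty => rw [Finset.image_empty, Finset.card_empty, pow_zero, Nat.cast_one, one_mul]
  | insert x s hx ih =>
    rw [Finset.image_insert, Finset.coe_insert, Ideal.span_insert, ← sup_assoc,
      Finset.card_insert_of_notMem hx, Finset.coe_insert, Ideal.span_insert, pow_succ]
    refine (ih _).trans ?_
    rw [Nat.cast_mul, mul_assoc, sup_right_comm, ← sup_assoc, sup_right_comm (b := Ideal.span {x})]
    gcongr
    exact length_quotient_sup_span_pow_le _ _ _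

variable {ι : Type*} [DecidableEq ι]

lemma span_range_update_le {v : ι → R} {i : ι} {f : R} {I : Ideal R} :
    Ideal.span (Set.range (Function.update v i f)) ≤ I ↔ f ∈ I ∧ ∀ j ≠ i, v j ∈ I := by
  rw [Ideal.span_le, Set.range_subset_iff]
  exact Function.forall_update_iff v fun _ x ↦ x ∈ I

lemma mem_span_range_update_self (v : ι → R) (i : ι) (f : R) :
    f ∈ Ideal.span (Set.range (Function.update v i f)) :=
  (span_range_update_le.mp le_rfl).1

lemma mem_span_range_update_of_ne (v : ι → R) {i j : ι} (h : j ≠ i) (f : R) :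
    v j ∈ Ideal.span (Set.range (Function.update v i f)) :=
  (span_range_update_le.mp le_rfl).2 j h

lemma span_range_update_mul_le (v : ι → R) (i : ι) (f g : R) :
    Ideal.span (Set.range (Function.update v i (f * g))) ≤
      Ideal.span (Set.range (Function.update v i f)) :=
  span_range_update_le.mpr ⟨Ideal.mul_mem_right _ _ (mem_span_range_update_self v i f),
    fun _ hj ↦ mem_span_range_update_of_ne v hj f⟩

variable [Fintype ι]

lemma sum_mul_update (s v : ι → R) (i : ι) (f : R) :
    ∑ j, s j * Function.update v i f j = s i * f + ∑ j ∈ Finset.univ.erase i, s j * v j := by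
  rw [← Finset.add_sum_erase _ _ (Finset.mem_univ i), Function.update_self]
  congr 1
  refine Finset.sum_congr rfl fun j hj ↦ ?_
  rw [Function.update_of_ne (Finset.ne_of_mem_erase hj)]

lemma mem_span_range_update_iff {v : ι → R} {i : ι} {f x : R} :
    x ∈ Ideal.span (Set.range (Function.update v i f)) ↔
      ∃ c : ι → R, c i * f + ∑ j ∈ Finset.univ.erase i, c j * v j = x := by
  simp_rw [Ideal.mem_span_range_iff_exists_fun, sum_mul_update]

namespace IsLechIndependent

variable {v : ι → R} {i : ι} {f g : R}

lemma mem_of_add_sum_eq_zero (h : IsLechIndependent (Function.update v i f)) {x : R} {c : ι → R}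
    (hx : x * f + ∑ j ∈ Finset.univ.erase i, c j * v j = 0) :
    x ∈ Ideal.span (Set.range (Function.update v i f)) ∧
      ∀ j ≠ i, c j ∈ Ideal.span (Set.range (Function.update v i f)) := by
  have hs := h (Function.update c i x) (by
    rw [sum_mul_update, Function.update_self, ← hx]
    congr 1
    refine Finset.sum_congr rfl fun j hj ↦ ?_
    rw [Function.update_of_ne (Finset.ne_of_mem_erase hj)])
  refine ⟨by simpa using hs i, fun j hj ↦ by simpa [hj] using hs j⟩

lemma update_left (h : IsLechIndependent (Function.update v i (f * g))) :
    IsLechIndependent (Function.update v i f) := by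
  have hle := span_range_update_mul_le v i f g
  intro s hs
  rw [sum_mul_update] at hs
  have h₁ : s i * (f * g) + ∑ j ∈ Finset.univ.erase i, (g * s j) * v j = 0 := by
    simp_rw [mul_assoc, ← Finset.mul_sum]
    linear_combination g * hs
  have hsi := (h.mem_of_add_sum_eq_zero h₁).1
  obtain ⟨c, hc⟩ := mem_span_range_update_iff.mp hsi
  have h₂ : (f * c i) * (f * g) + ∑ j ∈ Finset.univ.erase i, (s j + f * c j) * v j = 0 := by
    simp_rw [add_mul, Finset.sum_add_distrib, mul_assoc, ← Finset.mul_sum]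
    linear_combination hs + f * hc
  intro j
  by_cases hj : j = i
  · exact hj ▸ hle hsi
  · have := hle ((h.mem_of_add_sum_eq_zero h₂).2 j hj)
    rwa [Ideal.add_mem_iff_left _ (Ideal.mul_mem_right _ _ (mem_span_range_update_self v i f))]
      at this

lemma mem_of_mul_mem (h : IsLechIndependent (Function.update v i (f * g))) {x : R}
    (hx : x * f ∈ Ideal.span (Set.range (Function.update v i (f * g)))) :
    x ∈ Ideal.span (Set.range (Function.update v i g)) := by
  obtain ⟨c, hc⟩ := mem_span_range_update_iff.mp hx
  have h₁ : (x - c i * g) * (f * g) + ∑ j ∈ Finset.univ.erase i, (-g * c j) * v j = 0 := by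
    simp_rw [mul_assoc, ← Finset.mul_sum]
    linear_combination (-g) * hc
  have hle := span_range_update_mul_le v i g f
  rw [mul_comm] at hle
  have := hle (h.mem_of_add_sum_eq_zero h₁).1
  rw [← sub_add_cancel x (c i * g)]
  exact add_mem this (Ideal.mul_mem_left _ _ (mem_span_range_update_self v i g))

lemma length_add_length_le (h : IsLechIndependent (Function.update v i (f * g))) :
    Module.length R (R ⧸ Ideal.span (Set.range (Function.update v i g))) +
      Module.length R (R ⧸ Ideal.span (Set.range (Function.update v i f))) ≤
    Module.length R (R ⧸ Ideal.span (Set.range (Function.update v i (f * g)))) := by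
  rw [length_quotient_eq_colon_add (Ideal.span (Set.range (Function.update v i (f * g)))) f]
  have hcolon : (Submodule.comap (LinearMap.toSpanSingleton R R f)
      (Ideal.span (Set.range (Function.update v i (f * g)))) : Ideal R) ≤
      Ideal.span (Set.range (Function.update v i g)) := fun x hx ↦ h.mem_of_mul_mem hx
  have hsup : Ideal.span (Set.range (Function.update v i (f * g))) ⊔ Ideal.span {f} ≤
      Ideal.span (Set.range (Function.update v i f)) :=
    sup_le (span_range_update_mul_le v i f g)
      ((Ideal.span_singleton_le_iff_mem _).mpr (mem_span_range_update_self v i f))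
  exact add_le_add (length_quotient_anti hcolon) (length_quotient_anti hsup)

lemma mul_length_le (t : ℕ) (h : IsLechIndependent (Function.update v i (f ^ (t + 1)))) :
    (t + 1 : ℕ) * Module.length R (R ⧸ Ideal.span (Set.range (Function.update v i f))) ≤
      Module.length R (R ⧸ Ideal.span (Set.range (Function.update v i (f ^ (t + 1))))) := by
  induction t with
  | zero => rw [zero_add, pow_one, Nat.cast_one, one_mul]
  | succ t ih =>
    rw [pow_succ'] at h ⊢
    refine le_trans ?_ h.length_add_length_le
    rw [Nat.cast_succ, add_mul, one_mul]
    exact add_le_add_left (ih (update_left (g := f) (mul_comm f _ ▸ h))) _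

/-- **Lech's inequality** for independent elements. -/
lemma pow_card_mul_length_le {a : ι → R} {q : ℕ} (hq : 0 < q)
    (h : IsLechIndependent fun i ↦ a i ^ q) :
    (q ^ Fintype.card ι : ℕ) * Module.length R (R ⧸ Ideal.span (Set.range a)) ≤
      Module.length R (R ⧸ Ideal.span (Set.range fun i ↦ a i ^ q)) := by
  obtain ⟨t, rfl⟩ := Nat.exists_eq_succ_of_ne_zero hq.ne'
  suffices H : ∀ s : Finset ι,
      IsLechIndependent (fun i ↦ if i ∈ s then a i ^ (t + 1) else a i) →
      ((t + 1) ^ s.card : ℕ) * Module.length R (R ⧸ Ideal.span (Set.range a)) ≤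
      Module.length R
        (R ⧸ Ideal.span (Set.range fun i ↦ if i ∈ s then a i ^ (t + 1) else a i)) by
    have huniv : (fun i ↦ if i ∈ Finset.univ then a i ^ (t + 1) else a i) =
        fun i ↦ a i ^ (t + 1) := funext fun i ↦ if_pos (Finset.mem_univ i)
    have := H Finset.univ (huniv ▸ h)
    rwa [huniv, Finset.card_univ] at this
  intro s
  induction s using Finset.induction_on with
  | empty =>
    intro _
    have hempty : (fun i ↦ if i ∈ (∅ : Finset ι) then a i ^ (t + 1) else a i) = a :=
      funext fun i ↦ if_neg (Finset.notMem_empty i)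
    rw [hempty, Finset.card_empty, pow_zero, Nat.cast_one, one_mul]
  | insert i s hi ih =>
    intro hs
    let v : ι → R := fun i ↦ if i ∈ s then a i ^ (t + 1) else a i
    have hins : (fun j ↦ if j ∈ insert i s then a j ^ (t + 1) else a j) =
        Function.update v i (a i ^ (t + 1)) := by
      ext j
      by_cases hj : j = i
      · subst hj; simp
      · simp [hj, v]
    have hv : Function.update v i (a i) = v := by
      rw [Function.update_eq_self_iff]
      simp [v, hi]
    rw [hins] at hs ⊢
    have hvs : IsLechIndependent v := by
      rw [← hv]
      exact update_left (g := a i ^ t) (pow_succ' (a i) t ▸ hs)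
    rw [Finset.card_insert_of_notMem hi, pow_succ', Nat.cast_mul, mul_assoc]
    refine le_trans ?_ (hs.mul_length_le t)
    rw [hv]
    gcongr
    exact ih hvs

end IsLechIndependent

end LechIndependence

section Regularity

open IsLocalRing

variable {R : Type*} [CommRing R] [IsLocalRing R]

/-- The coefficients of a relation between minimal generators of `𝔪` lie in `𝔪`. -/
lemma mem_maximalIdeal_of_sum_mul_eq_zero {t : Finset R}
    (ht : Ideal.span (t : Set R) = maximalIdeal R)
    (hcard : t.card = (maximalIdeal R).spanFinrank) {r : t → R} (hr : ∑ i, r i * (i : R) = 0)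
    (i : t) : r i ∈ maximalIdeal R := by
  classical
  intro hu
  have hi : (i : R) ∈ Ideal.span (t.erase i : Set R) := by
    rw [← Ideal.unit_mul_mem_iff_mem _ hu]
    rw [← Finset.add_sum_erase _ _ (Finset.mem_univ i), ← eq_neg_iff_add_eq_zero] at hr
    rw [hr]
    refine neg_mem (Ideal.sum_mem _ fun j hj ↦ Ideal.mul_mem_left _ _ (Ideal.subset_span ?_))
    have hne : (j : R) ≠ i := fun h ↦ Finset.ne_of_mem_erase hj (Subtype.ext h)
    exact Finset.mem_coe.mpr (Finset.mem_erase.mpr ⟨hne, j.2⟩)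
  have hspan : Ideal.span (t.erase i : Set R) = maximalIdeal R := by
    rw [← ht]
    refine le_antisymm (Ideal.span_mono (Finset.coe_subset.mpr (Finset.erase_subset _ _))) ?_
    rw [Ideal.span_le]
    intro x hx
    by_cases hxi : x = i
    · exact hxi ▸ hi
    · exact Ideal.subset_span (Finset.mem_coe.mpr (Finset.mem_erase.mpr ⟨hxi, hx⟩))
  have hle := Submodule.spanFinrank_span_le_ncard_of_finite (R := R) (t.erase (i : R)).finite_toSet
  change (Ideal.span (t.erase i : Set R)).spanFinrank ≤ _ at hle
  rw [hspan, Set.ncard_coe_finset, ← hcard] at hle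
  exact (Finset.card_erase_lt_of_mem i.2).not_ge hle

variable [IsNoetherianRing R]

/-- If all Frobenius powers of a generating set of `𝔪` are Lech independent, then its
cardinality is at most the dimension. -/
lemma card_le_height_of_isLechIndependent {ι : Type*} [Fintype ι] {p : ℕ} (hp : p.Prime)
    [CharP R p] {a : ι → R} (ha : Ideal.span (Set.range a) = maximalIdeal R)
    (h : ∀ e : ℕ, IsLechIndependent fun i ↦ a i ^ p ^ e) :
    (Fintype.card ι : ℕ∞) ≤ (maximalIdeal R).height := by
  classical
  have := Fact.mk hp
  have := ExpChar.prime (R := R) hp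
  obtain ⟨s, hs, hcard⟩ := (maximalIdeal R).exists_finset_card_eq_height_of_isNoetherianRing
  rw [← hcard, Nat.cast_le]
  have hart : IsArtinianRing (R ⧸ Ideal.span (s : Set R)) :=
    quotient_artinian_of_mem_minimalPrimes_of_isLocalRing _ hs
  have hart' : IsArtinian R (R ⧸ Ideal.span (s : Set R)) :=
    isArtinian_of_surjective_algebraMap (R := R ⧸ Ideal.span (s : Set R))
      Ideal.Quotient.mk_surjective
  obtain ⟨C, hC⟩ := ENat.ne_top_iff_exists.mp
    (Module.length_ne_top (R := R) (M := R ⧸ Ideal.span (s : Set R)))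
  have key (e : ℕ) : (p ^ e) ^ Fintype.card ι ≤ (p ^ e) ^ s.card * C := by
    have hsub : Ideal.span (s.image (· ^ p ^ e) : Set R) ≤
        Ideal.span (Set.range fun i ↦ a i ^ p ^ e) := by
      rw [Ideal.span_le]
      intro y hy
      obtain ⟨x, hx, rfl⟩ := Finset.mem_image.mp (Finset.mem_coe.mp hy)
      have hxm : x ∈ Ideal.span (Set.range a) := ha ▸ hs.1.2 (Ideal.subset_span hx)
      obtain ⟨c, rfl⟩ := Ideal.mem_span_range_iff_exists_fun.mp hxm
      rw [SetLike.mem_coe]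
      simp only [sum_pow_char_pow, mul_pow]
      exact Ideal.sum_mem _ fun j _ ↦ Ideal.mul_mem_left _ _ (Ideal.subset_span ⟨j, rfl⟩)
    have hlow := (h e).pow_card_mul_length_le (pow_pos hp.pos e)
    have hup := length_quotient_sup_span_image_pow_le ⊥ s (p ^ e)
    rw [bot_sup_eq, bot_sup_eq, ← hC] at hup
    have hone : 1 ≤ Module.length R (R ⧸ Ideal.span (Set.range a)) := by
      rw [Order.one_le_iff_ne_zero, ha]
      exact Module.length_pos.ne'
    have := (le_mul_of_one_le_right' hone).trans (hlow.trans ((length_quotient_anti hsub).trans hup))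
    exact_mod_cast this
  by_contra! hlt
  have hC1 := key C
  have hle : (p ^ C) ^ s.card * p ^ C ≤ (p ^ C) ^ s.card * C := by
    rw [← pow_succ]
    exact (Nat.pow_le_pow_right (pow_pos hp.pos _) hlt).trans hC1
  exact (Nat.lt_pow_self hp.one_lt).not_ge
    (Nat.le_of_mul_le_mul_left hle (pow_pos (pow_pos hp.pos _) _))

/-- A Noetherian local ring `R` of characteristic `p` is regular as soon as it has a reduced
algebra `S` with surjective Frobenius and `𝔪 S ≠ S` such that `𝔪 ⊗ S → S` is injective. -/
theorem isRegularLocalRing_of_lTensor_maximalIdeal_injective {S : Type*} [CommRing S]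
    [Algebra R S] [IsReduced S] {p : ℕ} (hp : p.Prime) [CharP R p] [CharP S p]
    (hperf : ∀ x : S, ∃ y, y ^ p = x)
    (hS : (maximalIdeal R).map (algebraMap R S) ≠ ⊤)
    (h : Function.Injective ((maximalIdeal R).subtype.lTensor S)) :
    IsRegularLocalRing R := by
  have := ExpChar.prime (R := S) hp
  obtain ⟨t, hcard, ht⟩ := Submodule.FG.exists_span_finset_card_eq_spanFinrank
    (IsNoetherian.noetherian (maximalIdeal R))
  have ha : Ideal.span (Set.range ((↑) : t → R)) = maximalIdeal R := by
    rw [Subtype.range_coe_subtype]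
    exact ht
  apply IsRegularLocalRing.of_spanFinrank_maximalIdeal_le
  have hle : (t.card : ℕ∞) ≤ (maximalIdeal R).height := by
    rw [← Fintype.card_coe]
    refine card_le_height_of_isLechIndependent hp ha fun e r hr i ↦ ?_
    have hrad : maximalIdeal R ≤ (Ideal.span (Set.range fun j : t ↦ (j : R) ^ p ^ e)).radical := by
      rw [← ha, Ideal.span_le]
      rintro _ ⟨j, rfl⟩
      exact ⟨p ^ e, Ideal.subset_span ⟨j, rfl⟩⟩
    obtain ⟨N, hN⟩ := Ideal.exists_pow_le_of_le_radical_of_fg hrad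
      (maximalIdeal R).fg_of_isNoetherianRing
    refine mem_of_algebraMap_mem_map h hS hN ?_
    refine mem_span_pow_of_sum_eq_zero (s := fun i ↦ algebraMap R S (r i)) hperf h ha
      (fun r hr ↦ mem_maximalIdeal_of_sum_mul_eq_zero ht hcard hr) e ?_ i
    simpa using congrArg (algebraMap R S) hr
  rw [← hcard, ← maximalIdeal_height_eq_ringKrullDim]
  exact_mod_cast hle

end Regularity

section AbsIntClo

variable (R : Type) [CommRing R] [IsDomain R]

lemma AbsIntClo.exists_pow_eq {n : ℕ} (hn : 0 < n) (x : AbsIntClo R) :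
    ∃ y : AbsIntClo R, y ^ n = x := by
  obtain ⟨z, hz⟩ := IsAlgClosed.exists_pow_nat_eq (x : AlgebraicClosure (FractionRing R)) hn
  refine ⟨⟨z, IsIntegral.of_pow hn ?_⟩, Subtype.ext hz⟩
  rw [hz]
  exact x.2

instance AbsIntClo.faithfulSMul : FaithfulSMul R (AbsIntClo R) := by
  have : FaithfulSMul R (AlgebraicClosure (FractionRing R)) :=
    FaithfulSMul.trans R (FractionRing R) _
  rw [faithfulSMul_iff_algebraMap_injective]
  exact fun x y h ↦ FaithfulSMul.algebraMap_injective R (AlgebraicClosure (FractionRing R))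
    (congrArg Subtype.val h)

lemma AbsIntClo.map_maximalIdeal_ne_top [IsLocalRing R] :
    (IsLocalRing.maximalIdeal R).map (algebraMap R (AbsIntClo R)) ≠ ⊤ := by
  obtain ⟨Q, hQ, hQm⟩ :=
    (inferInstance : Nonempty ((IsLocalRing.maximalIdeal R).primesOver (AbsIntClo R)))
  exact ne_top_of_le_ne_top hQ.ne_top (Ideal.map_le_iff_le_comap.mpr hQm.over.le)

end AbsIntClo

/-- If `(R, 𝔪)` is an excellent local domain of prime characteristic `p` of Krull
dimension at most `2` and `Tor_1^R(R⁺, k) = 0`, then `R` is regular. -/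
theorem regular_of_tor_one_vanishing_dim_le_two
    (R : Type) [CommRing R] [IsDomain R] [IsNoetherianRing R] [IsLocalRing R]
    (hExc : IsExcellentRing R)
    (p : ℕ) (hp : p.Prime) [CharP R p]
    (hdim : ringKrullDim R ≤ 2)
    (htor : Subsingleton (TorGrp R 1 (AbsIntClo R) (IsLocalRing.ResidueField R))) :
    IsRegularLocalRingP R := by
  have hchar : CharP (AbsIntClo R) p :=
    charP_of_injective_algebraMap (FaithfulSMul.algebraMap_injective R (AbsIntClo R)) p
  obtain ⟨t, hcard, ht⟩ := Submodule.FG.exists_span_finset_card_eq_spanFinrank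
    (IsNoetherian.noetherian (IsLocalRing.maximalIdeal R))
  have hreg : IsRegularLocalRing R := isRegularLocalRing_of_lTensor_maximalIdeal_injective hp
    (AbsIntClo.exists_pow_eq R hp.pos) (AbsIntClo.map_maximalIdeal_ne_top R)
    (lTensor_maximalIdeal_injective_of_tor_one R (AbsIntClo R) htor)
  exact ⟨inferInstance, inferInstance, t, ht, hcard ▸ (isRegularLocalRing_iff R).mp hreg⟩
end

section
/- Let (R, 𝔪) be an excellent Noetherian local domain of prime characteristic p > 0 with residue field k = R/𝔪, and suppose Tor_1^R(R^+, k) = 0. Then every finite extension of R splits: for every injective ring homomorphism R → S which makes S a finitely generated R-module, there exists an R-module homomorphism φ : S → R with φ(1) = 1 (i.e. R → S is a split injection of R-modules). -/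
set_option synthInstance.maxHeartbeats 1000000
set_option maxHeartbeats 1000000
set_option linter.unusedVariables false

open CategoryTheory

open TensorProduct IsLocalRing Function

section

variable {R : Type} [CommRing R]

/-- If `Tor₁(B, k)` vanishes, tensoring with `B` preserves injectivity of maps with cokernel `k`. -/
theorem lTensor_injective_of_subsingleton_tor {B k M' M : Type} [AddCommGroup B] [Module R B]
    [AddCommGroup k] [Module R k] [AddCommGroup M'] [Module R M'] [AddCommGroup M] [Module R M]
    (htor : Subsingleton (TorGrp R 1 B k)) (f : M' →ₗ[R] M) (g : M →ₗ[R] k)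
    (hf : Injective f) (hfg : Exact f g) (hg : Surjective g) : Injective (f.lTensor B) := by
  let P := projectiveResolution (ModuleCat.of R k)
  let d₂ := (P.complex.d 2 1).hom
  let d₁ := (P.complex.d 1 0).hom
  let ε : P.complex.X 0 →ₗ[R] k := (P.π.f 0).hom
  have hε : Surjective ε := (ModuleCat.epi_iff_surjective (P.π.f 0)).1 inferInstance
  have hd₁ε : Exact d₁ ε :=
    (ShortComplex.ShortExact.moduleCat_exact_iff_function_exact _).1
      (ShortComplex.exact_of_g_is_cokernel
        (.mk (P.complex.d 1 0) (P.π.f 0) P.complex_d_comp_π_f_zero) P.isColimitCokernelCofork)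
  have hd : ∀ x, d₁ (d₂ x) = 0 := fun x => by
    have := P.complex.d_comp_d 2 1 0
    exact congrArg (fun h => h.hom x) this
  have hBd : Exact (d₂.lTensor B) (d₁.lTensor B) := by
    let F := (MonoidalCategory.tensoringLeft (ModuleCat R)).obj (ModuleCat.of R B)
    have h1 : Limits.IsZero ((F.leftDerived 1).obj (ModuleCat.of R k)) :=
      ModuleCat.isZero_of_iff_subsingleton.2 htor
    have h2 := h1.of_iso (P.isoLeftDerivedObj F 1).symm
    have h3 := (HomologicalComplex.exactAt_iff_isZero_homology _ _).2 h2
    rw [HomologicalComplex.exactAt_iff' _ 2 1 0 (by simp) (by simp)] at h3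
    exact (ShortComplex.ShortExact.moduleCat_exact_iff_function_exact _).1 h3
  obtain ⟨u, hu⟩ := Module.projective_lifting_property g ε hg
  let K := LinearMap.ker ε
  have hi : Injective (K.subtype.lTensor B) := by
    let e : P.complex.X 1 →ₗ[R] K := d₁.codRestrict K fun x => hd₁ε.apply_apply_eq_zero x
    have he : Surjective e := fun x => by
      obtain ⟨y, hy⟩ := (hd₁ε x).1 x.2
      exact ⟨y, Subtype.ext hy⟩
    refine (injective_iff_map_eq_zero _).2 fun w hw => ?_
    obtain ⟨v, rfl⟩ := LinearMap.lTensor_surjective B he w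
    rw [← LinearMap.comp_apply, ← LinearMap.lTensor_comp] at hw
    obtain ⟨y, rfl⟩ := (hBd v).1 hw
    have hed : e ∘ₗ d₂ = 0 := LinearMap.ext fun x => Subtype.ext (hd x)
    rw [← LinearMap.comp_apply, ← LinearMap.lTensor_comp, hed, LinearMap.lTensor_zero,
      LinearMap.zero_apply]
  let c : K →ₗ[R] M' := (LinearEquiv.ofInjective f hf).symm ∘ₗ
    (u ∘ₗ K.subtype).codRestrict (LinearMap.range f) fun x => (hfg _).1
      ((LinearMap.congr_fun hu x.1).trans x.2)
  have hc : ∀ x : K, f (c x) = u x.1 := fun x => congrArg Subtype.val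
    ((LinearEquiv.ofInjective f hf).apply_symm_apply _)
  let π : P.complex.X 0 × M' →ₗ[R] M := u.coprod f
  let j : K →ₗ[R] P.complex.X 0 × M' := K.subtype.prod (-c)
  have hπ : Surjective π := fun m => by
    obtain ⟨x, hx⟩ := hε (g m)
    obtain ⟨y, hy⟩ := (hfg (m - u x)).1 (by
      rw [map_sub, ← hx, ← hu, LinearMap.comp_apply, sub_self])
    exact ⟨(x, y), by simp [π, hy]⟩
  have hjπ : Exact j π := by
    rintro ⟨x, y⟩
    constructor
    · intro h
      have h : u x + f y = 0 := h
      have hx : ε x = 0 := by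
        have := congrArg g h
        rwa [map_add, hfg.apply_apply_eq_zero, add_zero, map_zero, ← LinearMap.comp_apply,
          hu] at this
      refine ⟨⟨x, hx⟩, Prod.ext rfl (hf ?_)⟩
      change f (-c ⟨x, hx⟩) = f y
      rw [map_neg, hc, neg_eq_iff_add_eq_zero, h]
    · rintro ⟨x, hx⟩
      rw [← hx]
      change u x.1 + f (-c x) = 0
      rw [map_neg, hc, add_neg_cancel]
  refine (injective_iff_map_eq_zero _).2 fun z hz => ?_
  have hz' : π.lTensor B ((LinearMap.inr R (P.complex.X 0) M').lTensor B z) = 0 := by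
    rwa [← LinearMap.comp_apply, ← LinearMap.lTensor_comp, LinearMap.coprod_inr]
  obtain ⟨w, hw⟩ := (lTensor_exact B hjπ hπ _).1 hz'
  have hw₀ : w = 0 := hi (by
    have := congrArg ((LinearMap.fst R (P.complex.X 0) M').lTensor B) hw
    rw [← LinearMap.comp_apply, ← LinearMap.lTensor_comp, ← LinearMap.comp_apply,
      ← LinearMap.lTensor_comp, LinearMap.fst_prod, LinearMap.fst_comp_inr] at this
    simpa using this)
  have := congrArg ((LinearMap.snd R (P.complex.X 0) M').lTensor B) hw
  rw [hw₀, map_zero, map_zero, ← LinearMap.comp_apply, ← LinearMap.lTensor_comp,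
    LinearMap.snd_comp_inr, LinearMap.lTensor_id, LinearMap.id_apply] at this
  exact this.symm

/-- A finite module modulo a power of the maximal ideal has finite length. -/
theorem isFiniteLength_quotient_maximalIdeal_pow [IsNoetherianRing R] [IsLocalRing R]
    (Q : Type) [AddCommGroup Q] [Module R Q] [Module.Finite R Q] (n : ℕ) :
    IsFiniteLength R (Q ⧸ (maximalIdeal R ^ (n + 1) • ⊤ : Submodule R Q)) := by
  have hne : maximalIdeal R ^ (n + 1) ≠ ⊤ := fun h =>
    (maximalIdeal.isMaximal R).ne_top (eq_top_iff.2 (h ▸ Ideal.pow_le_self n.succ_ne_zero))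
  have : Nontrivial (R ⧸ maximalIdeal R ^ (n + 1)) := Ideal.Quotient.nontrivial_iff.2 hne
  have : IsLocalRing (R ⧸ maximalIdeal R ^ (n + 1)) :=
    .of_surjective' _ Ideal.Quotient.mk_surjective
  have : IsArtinianRing (R ⧸ maximalIdeal R ^ (n + 1)) := by
    rw [isArtinianRing_iff_isNilpotent_maximalIdeal]
    refine ⟨n + 1, ?_⟩
    rw [← IsLocalRing.map_maximalIdeal_of_surjective (Ideal.Quotient.mk _)
      Ideal.Quotient.mk_surjective, ← Ideal.map_pow, Ideal.map_quotient_self, Ideal.zero_eq_bot]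
  have : Module.Finite (R ⧸ maximalIdeal R ^ (n + 1))
      (Q ⧸ (maximalIdeal R ^ (n + 1) • ⊤ : Submodule R Q)) :=
    .of_restrictScalars_finite R _ _
  rw [isFiniteLength_iff_isNoetherian_isArtinian]
  refine ⟨inferInstance, ?_⟩
  exact isArtinian_of_surjective_algebraMap (R := R ⧸ maximalIdeal R ^ (n + 1))
    Ideal.Quotient.mk_surjective

variable [IsLocalRing R]

/-- An integral extension of a local ring stays nontrivial after reduction modulo the maximal
ideal. -/
theorem nontrivial_tensor_residueField {B : Type} [CommRing B] [Algebra R B]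
    [Algebra.IsIntegral R B] (hB : Injective (algebraMap R B)) :
    Nontrivial (B ⊗[R] ResidueField R) := by
  obtain ⟨Q, hQ, hQm⟩ := Ideal.exists_ideal_over_maximal_of_isIntegral (S := B) (maximalIdeal R)
    (by rw [(RingHom.injective_iff_ker_eq_bot _).1 hB]; exact bot_le)
  let φ : ResidueField R →ₐ[R] B ⧸ Q := Ideal.Quotient.liftₐ (maximalIdeal R)
    (Algebra.ofId R (B ⧸ Q)) fun a ha => by
      rw [← hQm] at ha
      exact Ideal.Quotient.eq_zero_iff_mem.2 ha
  exact (Algebra.TensorProduct.lift (Ideal.Quotient.mkₐ R Q) φ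
    fun _ _ => .all _ _).toRingHom.domain_nontrivial

/-- If `Tor₁(B, k) = 0` for an integral extension `B` of `R`, then every module of finite length
embeds in its base change to `B`. -/
theorem mk_one_injective_of_isFiniteLength {B : Type} [CommRing B] [Algebra R B]
    [Algebra.IsIntegral R B] (hB : Injective (algebraMap R B))
    (htor : Subsingleton (TorGrp R 1 B (ResidueField R)))
    {M : Type} [AddCommGroup M] [Module R M] (hM : IsFiniteLength R M) :
    Injective (TensorProduct.mk R B M 1) := by
  induction hM with
  | of_subsingleton => exact injective_of_subsingleton _
  | @of_simple_quotient M _ _ N hs _ ih =>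
    obtain ⟨I, hI, ⟨e⟩⟩ := isSimpleModule_iff_quot_maximal.1 hs
    obtain rfl := eq_maximalIdeal hI
    let g : M →ₗ[R] ResidueField R := e.toLinearMap ∘ₗ N.mkQ
    have hg : Surjective g := e.surjective.comp N.mkQ_surjective
    have hNg : Exact N.subtype g := fun x => by
      change e (N.mkQ x) = 0 ↔ _
      rw [e.map_eq_zero_iff]
      simp
    have hN := lTensor_injective_of_subsingleton_tor htor N.subtype g N.injective_subtype hNg hg
    have hk : Injective (TensorProduct.mk R B (ResidueField R) 1) := by
      have := nontrivial_tensor_residueField hB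
      exact (Algebra.TensorProduct.includeRight :
        ResidueField R →ₐ[R] B ⊗[R] ResidueField R).toRingHom.injective
    refine (injective_iff_map_eq_zero _).2 fun x hx => ?_
    have hgx : g x = 0 := hk (by simpa using congrArg (g.lTensor B) hx)
    obtain ⟨y, rfl⟩ := (hNg x).1 hgx
    rw [(injective_iff_map_eq_zero _).1 ih y (hN (by simpa using hx)), map_zero]

/-- If `Tor₁(B, k) = 0` for an integral extension `B` of a Noetherian local ring `R`, then every
finite `R`-module embeds in its base change to `B`. -/
theorem mk_one_injective_of_finite [IsNoetherianRing R] {B : Type} [CommRing B] [Algebra R B]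
    [Algebra.IsIntegral R B] (hB : Injective (algebraMap R B))
    (htor : Subsingleton (TorGrp R 1 B (ResidueField R)))
    (Q : Type) [AddCommGroup Q] [Module R Q] [Module.Finite R Q] :
    Injective (TensorProduct.mk R B Q 1) := by
  refine (injective_iff_map_eq_zero _).2 fun x hx => ?_
  have hbot := (maximalIdeal R).iInf_pow_smul_eq_bot_of_isLocalRing (M := Q)
    (maximalIdeal.isMaximal R).ne_top
  rw [← Submodule.mem_bot R, ← hbot, Submodule.mem_iInf]
  intro n
  refine Submodule.smul_mono_left (Ideal.pow_le_pow_right n.le_succ) ?_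
  let q := (maximalIdeal R ^ (n + 1) • ⊤ : Submodule R Q).mkQ
  rw [← Submodule.Quotient.mk_eq_zero]
  exact mk_one_injective_of_isFiniteLength hB htor (isFiniteLength_quotient_maximalIdeal_pow Q n)
    (by simpa [q] using congrArg (q.lTensor B) hx)

end

/-- A finite algebra `S` over a Noetherian ring `R` with an algebra map to some `B` such that every
finite module embeds in its base change to `B` retracts onto `R`. -/
theorem exists_retraction_of_mk_one_injective {R B S : Type} [CommRing R] [IsNoetherianRing R]
    [CommRing B] [Algebra R B]
    (hB : ∀ (Q : Type) [AddCommGroup Q] [Module R Q] [Module.Finite R Q],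
      Injective (TensorProduct.mk R B Q 1))
    [CommRing S] [Algebra R S] [Module.Finite R S] (g : S →ₐ[R] B) :
    ∃ φ : S →ₗ[R] R, φ 1 = 1 := by
  classical
  obtain ⟨n, s, hs⟩ := Module.Finite.exists_fin (R := R) (M := S)
  let ψ : R × (Fin n → R) →ₗ[R] S :=
    (LinearMap.toSpanSingleton R S 1).coprod (Fintype.linearCombination R s)
  have hψ : Surjective ψ := by
    rw [← LinearMap.range_eq_top, LinearMap.range_coprod, Fintype.range_linearCombination, hs,
      sup_top_eq]
  obtain ⟨t, ht⟩ := IsNoetherian.noetherian (LinearMap.ker ψ)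
  let a : t → R := fun j => j.1.1
  let h : Fin n → t → R := fun i j => j.1.2 i
  have hrel : ∀ j : t, algebraMap R B (a j) + ∑ i, h i j • g (s i) = 0 := fun j => by
    have hj : ψ j.1 = 0 := ht.le (Submodule.subset_span j.2)
    simpa [ψ, Fintype.linearCombination_apply, a, h, Algebra.smul_def] using congrArg g hj
  let N := Submodule.span R (Set.range h)
  have ha : a ∈ N := by
    rw [← Submodule.Quotient.mk_eq_zero]
    refine (injective_iff_map_eq_zero _).1 (hB _) _ ?_
    have key : (1 : B) ⊗ₜ[R] a = -∑ i, g (s i) ⊗ₜ[R] h i := by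
      have hpi : ∀ v : t → R, v = ∑ j, v j • Pi.single j (1 : R) := fun v => by
        simpa using (Pi.basisFun R t).sum_repr v |>.symm
      have hten : ∀ (b : B) (v : t → R),
          b ⊗ₜ[R] v = ∑ j, (v j • b) ⊗ₜ[R] (Pi.single j (1 : R) : t → R) := fun b v => by
        conv_lhs => rw [hpi v]
        rw [TensorProduct.tmul_sum]
        exact Finset.sum_congr rfl fun j _ => (TensorProduct.smul_tmul _ _ _).symm
      rw [← add_eq_zero_iff_eq_neg]
      rw [hten 1 a, Finset.sum_congr rfl fun i _ => hten (g (s i)) (h i)]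
      rw [Finset.sum_comm, ← Finset.sum_add_distrib]
      refine Finset.sum_eq_zero fun j _ => ?_
      rw [← TensorProduct.sum_tmul, ← TensorProduct.add_tmul, ← Algebra.algebraMap_eq_smul_one,
        hrel, TensorProduct.zero_tmul]
    have := congrArg (N.mkQ.lTensor B) key
    rw [LinearMap.lTensor_tmul, map_neg, map_sum] at this
    rw [TensorProduct.mk_apply]
    refine this.trans ?_
    rw [Finset.sum_eq_zero, neg_zero]
    intro i _
    rw [LinearMap.lTensor_tmul, N.mkQ_apply,
      (Submodule.Quotient.mk_eq_zero N).2 (Submodule.subset_span ⟨i, rfl⟩), TensorProduct.tmul_zero]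
  obtain ⟨x, hx⟩ := (Submodule.mem_span_range_iff_exists_fun R).1 ha
  let θ : R × (Fin n → R) →ₗ[R] R :=
    LinearMap.id.coprod (-Fintype.linearCombination R x)
  have hθ : LinearMap.ker ψ ≤ LinearMap.ker θ := by
    rw [← ht, Submodule.span_le]
    intro v hv
    have := congrFun hx ⟨v, hv⟩
    simp only [Finset.sum_apply, Pi.smul_apply, smul_eq_mul, a, h] at this
    simp [θ, Fintype.linearCombination_apply, ← this, mul_comm]
  refine ⟨(LinearMap.ker ψ).liftQ θ hθ ∘ₗ (ψ.quotKerEquivOfSurjective hψ).symm, ?_⟩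
  have h1 : (ψ.quotKerEquivOfSurjective hψ).symm 1 = Submodule.Quotient.mk (1, 0) := by
    rw [LinearEquiv.symm_apply_eq]
    simp [ψ]
  rw [LinearMap.comp_apply, LinearEquiv.coe_coe, h1, Submodule.liftQ_apply]
  simp [θ]

theorem algebraMap_algebraicClosure_fractionRing_injective (R : Type) [CommRing R] [IsDomain R] :
    Injective (algebraMap R (AlgebraicClosure (FractionRing R))) := by
  rw [IsScalarTower.algebraMap_eq R (FractionRing R)]
  exact (algebraMap (FractionRing R) _).injective.comp (IsFractionRing.injective R _)

/-- An integral extension of a domain `R` maps to the absolute integral closure of `R`. -/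
theorem nonempty_algHom_absIntClo {R S : Type} [CommRing R] [IsDomain R] [CommRing S] [Algebra R S]
    [Algebra.IsIntegral R S] (hS : Injective (algebraMap R S)) :
    Nonempty (S →ₐ[R] AbsIntClo R) := by
  obtain ⟨P, -, hP, hP₀⟩ := Ideal.exists_ideal_over_prime_of_isIntegral (⊥ : Ideal R) (⊥ : Ideal S)
    (by rw [← RingHom.ker_eq_comap_bot, (RingHom.injective_iff_ker_eq_bot _).1 hS])
  have : FaithfulSMul R (S ⧸ P) := by
    rw [faithfulSMul_iff_algebraMap_injective, RingHom.injective_iff_ker_eq_bot, ← hP₀,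
      IsScalarTower.algebraMap_eq R S, RingHom.ker_eq_comap_bot, ← Ideal.comap_comap,
      ← RingHom.ker_eq_comap_bot]
    congr 1
    exact Ideal.mk_ker
  have : FaithfulSMul R (AlgebraicClosure (FractionRing R)) :=
    (faithfulSMul_iff_algebraMap_injective _ _).2
      (algebraMap_algebraicClosure_fractionRing_injective R)
  let f : S ⧸ P →ₐ[R] AlgebraicClosure (FractionRing R) := IsAlgClosed.lift
  exact ⟨(f.codRestrict (integralClosure R _) fun x =>
    (Algebra.IsIntegral.isIntegral (R := R) x).map f).comp (Ideal.Quotient.mkₐ R P)⟩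

/-- If `(R, 𝔪)` is an excellent local domain of prime characteristic `p` with
`Tor_1^R(R⁺, k) = 0`, then every finite extension of `R` splits: for every injective
ring map `R → S` making `S` a finite `R`-module there is an `R`-linear map `φ : S → R`
with `φ(1) = 1`. -/
theorem finite_extension_splits_of_tor_one_vanishing
    (R : Type) [CommRing R] [IsDomain R] [IsNoetherianRing R] [IsLocalRing R]
    (hExc : IsExcellentRing R)
    (p : ℕ) (hp : p.Prime) [CharP R p]
    (htor : Subsingleton (TorGrp R 1 (AbsIntClo R) (IsLocalRing.ResidueField R))) :
    ∀ (S : Type) (_ : CommRing S) (_ : Algebra R S),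
      Function.Injective (algebraMap R S) → Module.Finite R S →
        ∃ φ : S →ₗ[R] R, φ 1 = 1 := by
  intro S _ _ hS _
  obtain ⟨g⟩ := nonempty_algHom_absIntClo hS
  exact exists_retraction_of_mk_one_injective
    (mk_one_injective_of_finite (fun _ _ h => algebraMap_algebraicClosure_fractionRing_injective R
      (congrArg Subtype.val h)) htor) g
end

section
/- Let (R, 𝔪) be an excellent Noetherian local domain of prime characteristic p > 0 with residue field k = R/𝔪, and suppose Tor_1^R(R^+, k) = 0. Then every ideal of R is Frobenius-closed: for every ideal I of R, every a ∈ R, and every power q = p^e (e ≥ 1), if a^q belongs to the ideal I^{[q]} generated by the q-th powers of the elements of I, then a ∈ I. -/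
set_option synthInstance.maxHeartbeats 1000000
set_option maxHeartbeats 1000000
set_option linter.unusedVariables false

open CategoryTheory

theorem exists_presentation_lTensor_exact (R : Type) [CommRing R]
    (M N : Type) [AddCommGroup M] [Module R M] [AddCommGroup N] [Module R N]
    (h : Subsingleton (TorGrp R 1 M N)) :
    ∃ (P₂ P₁ P₀ : ModuleCat.{0} R) (d₂ : P₂ →ₗ[R] P₁) (d₁ : P₁ →ₗ[R] P₀) (π : P₀ →ₗ[R] N),
      Module.Projective R P₀ ∧ d₁ ∘ₗ d₂ = 0 ∧ Function.Exact d₁ π ∧ Function.Surjective π ∧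
      Function.Exact (d₂.lTensor M) (d₁.lTensor M) := by
  obtain ⟨P⟩ := HasProjectiveResolution.out (Z := ModuleCat.of R N)
  refine ⟨P.complex.X 2, P.complex.X 1, P.complex.X 0, (P.complex.d 2 1).hom,
    (P.complex.d 1 0).hom, (P.π.f 0).hom, ?_, ?_, ?_, ?_, ?_⟩
  · rw [IsProjective.iff_projective]
    exact P.projective 0
  · rw [← ModuleCat.hom_comp, P.complex.d_comp_d]
    rfl
  · exact (ShortComplex.ShortExact.moduleCat_exact_iff_function_exact _).1 P.exact₀
  · exact (ModuleCat.epi_iff_surjective _).1 inferInstance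
  · set F := (MonoidalCategory.tensoringLeft (ModuleCat R)).obj (ModuleCat.of R M)
    have hz : Limits.IsZero ((F.leftDerived 1).obj (ModuleCat.of R N)) :=
      ModuleCat.isZero_of_iff_subsingleton.2 h
    have hz' := hz.of_iso (P.isoLeftDerivedObj F 1).symm
    have hex : ((F.mapHomologicalComplex (ComplexShape.down ℕ)).obj P.complex).ExactAt 1 :=
      (HomologicalComplex.exactAt_iff_isZero_homology _ _).2 hz'
    rw [HomologicalComplex.exactAt_iff' _ 2 1 0 (by simp) (by simp)] at hex
    exact (ShortComplex.ShortExact.moduleCat_exact_iff_function_exact _).1 hex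

theorem lTensor_injective_of_tor_one_subsingleton (R : Type) [CommRing R]
    (M N : Type) [AddCommGroup M] [Module R M] [AddCommGroup N] [Module R N]
    (h : Subsingleton (TorGrp R 1 M N)) {A B : Type*} [AddCommGroup A] [Module R A]
    [AddCommGroup B] [Module R B] (i : A →ₗ[R] B) (q : B →ₗ[R] N)
    (hi : Function.Injective i) (hiq : Function.Exact i q)
    (hq : Function.Surjective q) :
    Function.Injective (i.lTensor M) := by
  obtain ⟨P₂, P₁, P₀, d₂, d₁, π, hP, hd, hex, hπ, hT⟩ :=
    exists_presentation_lTensor_exact R M N h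
  obtain ⟨g, hg⟩ := Module.projective_lifting_property q π hq
  have hg' : ∀ y, q (g y) = π y := fun y => LinearMap.congr_fun hg y
  have hmem : ∀ z, g (d₁ z) ∈ LinearMap.range i := fun z =>
    (hiq _).1 (by rw [hg', hex.apply_apply_eq_zero])
  obtain ⟨f, hf⟩ : ∃ f : P₁ →ₗ[R] A, ∀ z, i (f z) = g (d₁ z) :=
    ⟨(LinearEquiv.ofInjective i hi).symm ∘ₗ (g ∘ₗ d₁).codRestrict _ hmem, fun z =>
      congrArg Subtype.val ((LinearEquiv.ofInjective i hi).apply_symm_apply ⟨g (d₁ z), hmem z⟩)⟩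
  have hfd : f ∘ₗ d₂ = 0 := by
    ext w
    apply hi
    have : d₁ (d₂ w) = 0 := LinearMap.congr_fun hd w
    simp [hf, this]
  have hexact : Function.Exact (f.prod (-d₁)) (i.coprod g) := by
    rintro ⟨x, y⟩
    constructor
    · intro hxy
      have hxy : i x + g y = 0 := hxy
      have hy : π y = 0 := by
        simpa [hiq.apply_apply_eq_zero, hg'] using congrArg q hxy
      obtain ⟨z, rfl⟩ := (hex y).1 hy
      refine ⟨-z, Prod.ext (hi ?_) (by simp)⟩
      rw [eq_neg_of_add_eq_zero_left hxy, ← hf, ← map_neg, ← map_neg]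
      rfl
    · rintro ⟨z, hz⟩
      rw [← hz]
      simp [hf]
  have hsurj : Function.Surjective (i.coprod g) := by
    intro b
    obtain ⟨y, hy⟩ := hπ (q b)
    obtain ⟨x, hx⟩ := (hiq (b - g y)).1 (by rw [map_sub, hg', hy, sub_self])
    exact ⟨(x, y), by simp [hx]⟩
  rw [← LinearMap.ker_eq_bot, LinearMap.ker_eq_bot']
  intro x hx
  obtain ⟨z, hz⟩ := (lTensor_exact M hexact hsurj ((LinearMap.inl R A P₀).lTensor M x)).1 (by
    rw [← LinearMap.comp_apply, ← LinearMap.lTensor_comp, LinearMap.coprod_inl, hx])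
  have h1 := congrArg ((LinearMap.fst R A P₀).lTensor M) hz
  have h2 := congrArg ((LinearMap.snd R A P₀).lTensor M) hz
  simp only [← LinearMap.comp_apply, ← LinearMap.lTensor_comp, LinearMap.fst_prod,
    LinearMap.snd_prod, LinearMap.fst_comp_inl, LinearMap.snd_comp_inl, LinearMap.lTensor_id,
    LinearMap.lTensor_neg, LinearMap.neg_apply, LinearMap.id_apply, LinearMap.lTensor_zero,
    LinearMap.zero_apply, neg_eq_zero] at h1 h2
  obtain ⟨w, rfl⟩ := (hT z).1 h2
  rw [← h1, ← LinearMap.comp_apply, ← LinearMap.lTensor_comp, hfd]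
  simp

open IsLocalRing in
theorem exists_linearMap_residueField {R : Type*} [CommRing R] [IsLocalRing R] (J : Ideal R) {b : R}
    (hb : b ∉ J) (hmb : ∀ r ∈ maximalIdeal R, r * b ∈ J) :
    ∃ φ : (J ⊔ Ideal.span {b} : Ideal R) →ₗ[R] ResidueField R,
      (∀ x, φ x = 0 ↔ (x : R) ∈ J) ∧
      φ ⟨b, Ideal.mem_sup_right (Ideal.mem_span_singleton_self b)⟩ = 1 := by
  set B : Ideal R := J ⊔ Ideal.span {b}
  let b' : B := ⟨b, Ideal.mem_sup_right (Ideal.mem_span_singleton_self b)⟩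
  let A : Submodule R B := Submodule.comap B.subtype J
  let ψ : R →ₗ[R] B ⧸ A := A.mkQ ∘ₗ LinearMap.toSpanSingleton R B b'
  have hψ : ∀ r, ψ r = 0 ↔ r * b ∈ J := fun r => Submodule.Quotient.mk_eq_zero A
  have hker : LinearMap.ker ψ = maximalIdeal R := by
    ext r
    rw [LinearMap.mem_ker, hψ]
    refine ⟨fun h => ?_, hmb r⟩
    rw [mem_maximalIdeal, mem_nonunits_iff]
    exact fun hu => hb ((Ideal.unit_mul_mem_iff_mem J hu).1 h)
  have hsurj : Function.Surjective ψ := by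
    intro y
    obtain ⟨⟨x, hx⟩, rfl⟩ := A.mkQ_surjective y
    obtain ⟨j, hj, c, hc, rfl⟩ := Submodule.mem_sup.1 hx
    obtain ⟨r, rfl⟩ := Ideal.mem_span_singleton'.1 hc
    refine ⟨r, (Submodule.Quotient.eq A).2 ?_⟩
    change r * b - (j + r * b) ∈ J
    simpa using hj
  let e : ResidueField R ≃ₗ[R] B ⧸ A :=
    (Submodule.quotEquivOfEq _ _ hker.symm) ≪≫ₗ ψ.quotKerEquivOfSurjective hsurj
  refine ⟨e.symm ∘ₗ A.mkQ, fun x => ?_, ?_⟩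
  · simp only [LinearMap.comp_apply, LinearEquiv.coe_coe, LinearEquiv.map_eq_zero_iff]
    exact Submodule.Quotient.mk_eq_zero A
  · simp only [LinearMap.comp_apply, LinearEquiv.coe_coe]
    rw [LinearEquiv.symm_apply_eq]
    change _ = ψ 1
    change _ = A.mkQ ((1 : R) • b')
    rw [one_smul]

theorem residueField_linearMap_surjective {R : Type*} [CommRing R] [IsLocalRing R]
    {B : Type*} [AddCommGroup B] [Module R B] (φ : B →ₗ[R] IsLocalRing.ResidueField R) {b : B}
    (hb : φ b = 1) : Function.Surjective φ := by
  intro y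
  obtain ⟨r, rfl⟩ := IsLocalRing.residue_surjective y
  exact ⟨r • b, by rw [map_smul, hb, Algebra.smul_def, mul_one]; rfl⟩

open IsLocalRing in
theorem exists_notMem_forall_mul_mem {R : Type*} [CommRing R] [IsLocalRing R] {J : Ideal R}
    (hJ : J ≠ ⊤) {n : ℕ} (hn : maximalIdeal R ^ n ≤ J) :
    ∃ b ∉ J, ∀ r ∈ maximalIdeal R, r * b ∈ J := by
  induction n with
  | zero => exact absurd (top_le_iff.1 (by simpa using hn)) hJ
  | succ n ih =>
    by_cases h : maximalIdeal R ^ n ≤ J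
    · exact ih h
    · obtain ⟨b, hb, hbJ⟩ := SetLike.not_le_iff_exists.1 h
      refine ⟨b, hbJ, fun r hr => hn ?_⟩
      rw [pow_succ']
      exact Ideal.mul_mem_mul hr hb

open IsLocalRing in
theorem lTensor_inclusion_injective {R : Type} [CommRing R] [IsLocalRing R]
    (M : Type) [AddCommGroup M] [Module R M] (h : Subsingleton (TorGrp R 1 M (ResidueField R)))
    {J : Ideal R} {b : R} (hb : b ∉ J) (hmb : ∀ r ∈ maximalIdeal R, r * b ∈ J) :
    Function.Injective ((Submodule.inclusion (le_sup_left : J ≤ J ⊔ Ideal.span {b})).lTensor M) := by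
  obtain ⟨φ, hφ, hφb⟩ := exists_linearMap_residueField J hb hmb
  refine lTensor_injective_of_tor_one_subsingleton R M (ResidueField R) h _ φ
    (Submodule.inclusion_injective _) (fun x => ?_) (residueField_linearMap_surjective φ hφb)
  rw [hφ]
  exact ⟨fun hx => ⟨⟨x, hx⟩, rfl⟩, by rintro ⟨y, rfl⟩; exact y.2⟩

open IsLocalRing in
theorem lTensor_subtype_injective_of_maximalIdeal_pow_le {R : Type} [CommRing R]
    [IsNoetherianRing R] [IsLocalRing R] (M : Type) [AddCommGroup M] [Module R M]
    (h : Subsingleton (TorGrp R 1 M (ResidueField R))) (n : ℕ) (J : Ideal R)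
    (hn : maximalIdeal R ^ n ≤ J) : Function.Injective (J.subtype.lTensor M) := by
  induction J using WellFoundedGT.induction with
  | ind J ih =>
    by_cases hJ : J = ⊤
    · subst hJ
      exact (LinearEquiv.lTensor M (Submodule.topEquiv (R := R) (M := R))).injective
    · obtain ⟨b, hb, hmb⟩ := exists_notMem_forall_mul_mem hJ hn
      have hlt : J < J ⊔ Ideal.span {b} :=
        left_lt_sup.2 fun hle => hb (hle (Ideal.mem_span_singleton_self b))
      have hcomp := (ih _ hlt (hn.trans le_sup_left)).comp (lTensor_inclusion_injective M h hb hmb)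
      rwa [← LinearMap.coe_comp, ← LinearMap.lTensor_comp, Submodule.subtype_comp_inclusion]
        at hcomp

open TensorProduct in
theorem exists_lTensor_subtype_eq_of_mem_map {R S : Type*} [CommRing R] [CommRing S] [Algebra R S]
    (J : Ideal R) {s : S} (hs : s ∈ J.map (algebraMap R S)) :
    ∃ t : S ⊗[R] J, J.subtype.lTensor S t = s ⊗ₜ[R] (1 : R) := by
  induction hs using Submodule.span_induction with
  | mem s hs =>
    obtain ⟨j, hj, rfl⟩ := hs
    refine ⟨1 ⊗ₜ ⟨j, hj⟩, ?_⟩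
    rw [LinearMap.lTensor_tmul, Algebra.algebraMap_eq_smul_one, smul_tmul]
    simp
  | zero => exact ⟨0, by simp⟩
  | add x y _ _ hx hy =>
    obtain ⟨t, ht⟩ := hx
    obtain ⟨u, hu⟩ := hy
    exact ⟨t + u, by rw [map_add, ht, hu, add_tmul]⟩
  | smul c x _ hx =>
    obtain ⟨t, ht⟩ := hx
    refine ⟨c • t, ?_⟩
    have := (J.subtype.baseChange S).map_smul c t
    rw [← smul_tmul', ← ht]
    exact this

open IsLocalRing TensorProduct in
theorem mem_of_algebraMap_mem_map_of_maximalIdeal_pow_le {R S : Type} [CommRing R]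
    [IsNoetherianRing R] [IsLocalRing R] [CommRing S] [Algebra R S]
    (h : Subsingleton (TorGrp R 1 S (ResidueField R)))
    (hS : (maximalIdeal R).map (algebraMap R S) ≠ ⊤) {n : ℕ} {I : Ideal R}
    (hn : maximalIdeal R ^ n ≤ I) {a : R} (ha : algebraMap R S a ∈ I.map (algebraMap R S)) :
    a ∈ I := by
  by_contra haI
  set J : Ideal R := I ⊔ maximalIdeal R * Ideal.span {a}
  have haJ : a ∉ J := by
    intro haJ
    obtain ⟨j, hj, c, hc, hjc⟩ := Submodule.mem_sup.1 haJ
    obtain ⟨r, hr, rfl⟩ := Ideal.mem_mul_span_singleton.1 hc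
    have hu : IsUnit (1 - r) := isUnit_one_sub_self_of_mem_nonunits r hr
    refine haI ((Ideal.unit_mul_mem_iff_mem I hu).1 ?_)
    rwa [sub_mul, one_mul, ← eq_sub_of_add_eq hjc]
  have hma : ∀ r ∈ maximalIdeal R, r * a ∈ J := fun r hr =>
    Ideal.mem_sup_right (Ideal.mul_mem_mul hr (Ideal.mem_span_singleton_self a))
  obtain ⟨φ, hφ, hφa⟩ := exists_linearMap_residueField J haJ hma
  obtain ⟨t, ht⟩ := exists_lTensor_subtype_eq_of_mem_map J (Ideal.map_mono le_sup_left ha)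
  set a' : (J ⊔ Ideal.span {a} : Ideal R) :=
    ⟨a, Ideal.mem_sup_right (Ideal.mem_span_singleton_self a)⟩
  have hinc : (Submodule.inclusion (le_sup_left : J ≤ J ⊔ Ideal.span {a})).lTensor S t
      = 1 ⊗ₜ a' := by
    apply lTensor_subtype_injective_of_maximalIdeal_pow_le S h n _
      (hn.trans (le_sup_left.trans le_sup_left))
    rw [← LinearMap.comp_apply, ← LinearMap.lTensor_comp, Submodule.subtype_comp_inclusion, ht,
      LinearMap.lTensor_tmul, Algebra.algebraMap_eq_smul_one, smul_tmul]
    simp [a']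
  have hzero : φ ∘ₗ Submodule.inclusion (le_sup_left : J ≤ J ⊔ Ideal.span {a}) = 0 :=
    LinearMap.ext fun x => (hφ _).2 x.2
  have hone : (1 : S) ⊗ₜ[R] (1 : ResidueField R) = 0 := by
    have := congrArg (φ.lTensor S) hinc
    rw [← LinearMap.comp_apply, ← LinearMap.lTensor_comp, hzero, LinearMap.lTensor_tmul, hφa]
      at this
    simpa using this.symm
  have hmk := (congrArg (tensorQuotEquivQuotSMul S (maximalIdeal R)) hone).trans
    (tensorQuotEquivQuotSMul S (maximalIdeal R)).map_zero
  have hmk' := (tensorQuotEquivQuotSMul_tmul_mk (maximalIdeal R) (1 : S) 1).symm.trans hmk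
  rw [one_smul, Submodule.Quotient.mk_eq_zero, Ideal.smul_top_eq_map] at hmk'
  exact hS ((Ideal.eq_top_iff_one _).2 hmk')

open IsLocalRing in
theorem mem_of_forall_mem_sup_maximalIdeal_pow {R : Type*} [CommRing R] [IsNoetherianRing R]
    [IsLocalRing R] {I : Ideal R} {a : R} (h : ∀ n, a ∈ I ⊔ maximalIdeal R ^ n) : a ∈ I := by
  rw [← Ideal.Quotient.eq_zero_iff_mem, ← Submodule.mem_bot R,
    ← Ideal.iInf_pow_smul_eq_bot_of_isLocalRing (M := R ⧸ I) (maximalIdeal R)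
      (Ideal.IsPrime.ne_top inferInstance), Submodule.mem_iInf]
  intro n
  obtain ⟨i, hi, x, hx, rfl⟩ := Submodule.mem_sup.1 (h n)
  have : Ideal.Quotient.mk I (i + x) = x • (1 : R ⧸ I) := by
    rw [map_add, Ideal.Quotient.eq_zero_iff_mem.2 hi, zero_add, Algebra.smul_def, mul_one]
    rfl
  rw [this]
  exact Submodule.smul_mem_smul hx trivial

theorem algebraMap_mem_map_of_pow_mem_span_pow {R S : Type*} [CommRing R] [CommRing S]
    [Algebra R S] [IsReduced S] (p : ℕ) [ExpChar S p] (e : ℕ)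
    (hroot : ∀ r : R, ∃ s : S, s ^ p ^ e = algebraMap R S r) {I : Ideal R} {a : R}
    (ha : a ^ p ^ e ∈ Ideal.span ((fun x => x ^ p ^ e) '' (I : Set R))) :
    algebraMap R S a ∈ I.map (algebraMap R S) := by
  have key : ∀ y ∈ Ideal.span ((fun x => x ^ p ^ e) '' (I : Set R)),
      ∃ z ∈ I.map (algebraMap R S), z ^ p ^ e = algebraMap R S y := by
    intro y hy
    induction hy using Submodule.span_induction with
    | mem y hy =>
      obtain ⟨x, hx, rfl⟩ := hy
      exact ⟨algebraMap R S x, Ideal.mem_map_of_mem _ hx, by simp⟩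
    | zero => exact ⟨0, zero_mem _, by simp [(expChar_pos S p).ne']⟩
    | add x y _ _ hx hy =>
      obtain ⟨u, hu, hux⟩ := hx
      obtain ⟨v, hv, hvy⟩ := hy
      exact ⟨u + v, add_mem hu hv, by rw [add_pow_expChar_pow, hux, hvy, map_add]⟩
    | smul c x _ hx =>
      obtain ⟨u, hu, hux⟩ := hx
      obtain ⟨s, hs⟩ := hroot c
      exact ⟨s * u, Ideal.mul_mem_left _ _ hu, by rw [mul_pow, hs, hux, smul_eq_mul, map_mul]⟩
  obtain ⟨z, hz, hza⟩ := key _ ha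
  rw [map_pow] at hza
  have hz_eq : z = algebraMap R S a :=
    iterateFrobenius_inj S p e (by simpa [iterateFrobenius_def] using hza)
  exact hz_eq ▸ hz

theorem AbsIntClo.algebraMap_injective (R : Type) [CommRing R] [IsDomain R] :
    Function.Injective (algebraMap R (AbsIntClo R)) := fun _ _ hxy =>
  IsFractionRing.injective R (FractionRing R)
    ((algebraMap (FractionRing R) (AlgebraicClosure (FractionRing R))).injective
      (congrArg Subtype.val hxy))

theorem AbsIntClo.exists_pow_eq_s9 {R : Type} [CommRing R] [IsDomain R] {n : ℕ} (hn : 0 < n) (r : R) :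
    ∃ s : AbsIntClo R, s ^ n = algebraMap R (AbsIntClo R) r := by
  obtain ⟨z, hz⟩ := IsAlgClosed.exists_pow_nat_eq
    (algebraMap R (AlgebraicClosure (FractionRing R)) r) hn
  exact ⟨⟨z, IsIntegral.of_pow hn (hz ▸ isIntegral_algebraMap)⟩, Subtype.ext hz⟩

/-- If `(R, 𝔪)` is an excellent local domain of prime characteristic `p` with
`Tor_1^R(R⁺, k) = 0`, then every ideal of `R` is Frobenius-closed: if `a^q ∈ I^{[q]}`
for some `q = p^e` with `e ≥ 1`, then `a ∈ I`. -/
theorem ideals_frobenius_closed_of_tor_one_vanishing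
    (R : Type) [CommRing R] [IsDomain R] [IsNoetherianRing R] [IsLocalRing R]
    (hExc : IsExcellentRing R)
    (p : ℕ) (hp : p.Prime) [CharP R p]
    (htor : Subsingleton (TorGrp R 1 (AbsIntClo R) (IsLocalRing.ResidueField R))) :
    ∀ (I : Ideal R) (a : R) (e : ℕ), 1 ≤ e →
      a ^ p ^ e ∈ Ideal.span ((fun x => x ^ p ^ e) '' (I : Set R)) → a ∈ I := by
  intro I a e _ ha
  have : Fact p.Prime := ⟨hp⟩
  have hinj := AbsIntClo.algebraMap_injective R
  have : CharP (AbsIntClo R) p := charP_of_injective_algebraMap hinj p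
  have hS : (IsLocalRing.maximalIdeal R).map (algebraMap R (AbsIntClo R)) ≠ ⊤ := by
    rw [Ne, Ideal.map_eq_top_iff _ hinj (algebraMap_isIntegral_iff.2 inferInstance)]
    exact Ideal.IsPrime.ne_top inferInstance
  have haS : algebraMap R (AbsIntClo R) a ∈ I.map (algebraMap R (AbsIntClo R)) :=
    algebraMap_mem_map_of_pow_mem_span_pow p e
      (AbsIntClo.exists_pow_eq_s9 (pow_pos hp.pos e)) ha
  exact mem_of_forall_mem_sup_maximalIdeal_pow fun n =>
    mem_of_algebraMap_mem_map_of_maximalIdeal_pow_le htor hS le_sup_right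
      (Ideal.map_mono le_sup_left haS)
end

section
/- Let (R, 𝔪) be an excellent Noetherian local domain of prime characteristic p > 0 with residue field k = R/𝔪, and suppose Tor_1^R(R^+, k) = 0. Then every ideal of R is plus-closed: IR^+ ∩ R = I for every ideal I of R, where IR^+ ∩ R is the preimage of the extension of I under the inclusion R → R^+. -/
set_option synthInstance.maxHeartbeats 1000000
set_option maxHeartbeats 1000000
set_option linter.unusedVariables false

open CategoryTheory

section

variable {R : Type*} [CommRing R] {P₂ P₁ P₀ C K L : Type*}
  [AddCommGroup P₂] [AddCommGroup P₁] [AddCommGroup P₀] [AddCommGroup C]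
  [AddCommGroup K] [AddCommGroup L]
  [Module R P₂] [Module R P₁] [Module R P₀] [Module R C] [Module R K] [Module R L]

/-- If tensoring the start `P₂ → P₁ → P₀ → C → 0` of a resolution with `M` is exact at `P₁`, then
`M ⊗ -` preserves injectivity of `K → L` whenever `0 → K → L → C → 0` is exact. -/
theorem LinearMap.lTensor_injective_of_exact_resolution
    (M : Type*) [AddCommGroup M] [Module R M] [Module.Projective R P₀]
    {d₂ : P₂ →ₗ[R] P₁} {d₁ : P₁ →ₗ[R] P₀} {π : P₀ →ₗ[R] C}
    (hd : d₁ ∘ₗ d₂ = 0) (hex : Function.Exact d₁ π) (hπ : Function.Surjective π)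
    (hM : Function.Exact (d₂.lTensor M) (d₁.lTensor M))
    {f : K →ₗ[R] L} {g : L →ₗ[R] C} (hf : Function.Injective f)
    (hfg : Function.Exact f g) (hg : Function.Surjective g) :
    Function.Injective (f.lTensor M) := by
  obtain ⟨h, hh⟩ := Module.projective_lifting_property g π hg
  have hh' (x : P₀) : g (h x) = π x := LinearMap.congr_fun hh x
  have hrange (x : P₁) : h (d₁ x) ∈ LinearMap.range f :=
    (hfg _).1 ((hh' _).trans (hex.apply_apply_eq_zero x))
  let t : P₁ →ₗ[R] K :=
    (LinearEquiv.ofInjective f hf).symm.toLinearMap ∘ₗ (h ∘ₗ d₁).codRestrict _ hrange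
  have ht (x : P₁) : f (t x) = h (d₁ x) := by
    have := (LinearEquiv.ofInjective f hf).apply_symm_apply ⟨h (d₁ x), hrange x⟩
    exact congrArg Subtype.val this
  have htd : t ∘ₗ d₂ = 0 := by
    ext x
    apply hf
    simpa [ht] using congrArg h (LinearMap.congr_fun hd x)
  have huv : Function.Exact (t.prod d₁)
      (f ∘ₗ LinearMap.fst R K P₀ - h ∘ₗ LinearMap.snd R K P₀) := by
    rintro ⟨k, q⟩
    constructor
    · intro hkq
      have hkq : f k = h q := by simpa [sub_eq_zero] using hkq
      obtain ⟨y, rfl⟩ := (hex q).1 (by rw [← hh', ← hkq, hfg.apply_apply_eq_zero])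
      exact ⟨y, Prod.ext (hf ((ht y).trans hkq.symm)) rfl⟩
    · rintro ⟨y, hy⟩
      rw [← hy]
      simp [ht]
  have hv : Function.Surjective (f ∘ₗ LinearMap.fst R K P₀ - h ∘ₗ LinearMap.snd R K P₀) := by
    intro l
    obtain ⟨q, hq⟩ := hπ (g l)
    obtain ⟨k, hk⟩ := (hfg (l - h q)).1 (by rw [map_sub, hh', hq, sub_self])
    exact ⟨(k, -q), by simp [hk]⟩
  rw [injective_iff_map_eq_zero]
  intro x hx
  obtain ⟨y, hy⟩ := (lTensor_exact M huv hv ((LinearMap.inl R K P₀).lTensor M x)).1 (by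
    rw [← LinearMap.comp_apply, ← LinearMap.lTensor_comp]
    convert hx using 3
    ext
    simp)
  have hy₁ : t.lTensor M y = x := by
    have := congrArg ((LinearMap.fst R K P₀).lTensor M) hy
    simpa only [← LinearMap.comp_apply, ← LinearMap.lTensor_comp, LinearMap.fst_prod,
      LinearMap.fst_comp_inl, LinearMap.lTensor_id, LinearMap.id_apply] using this
  have hy₂ : d₁.lTensor M y = 0 := by
    have := congrArg ((LinearMap.snd R K P₀).lTensor M) hy
    simpa only [← LinearMap.comp_apply, ← LinearMap.lTensor_comp, LinearMap.snd_prod,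
      LinearMap.snd_comp_inl, LinearMap.lTensor_zero, LinearMap.zero_apply] using this
  obtain ⟨w, rfl⟩ := (hM y).1 hy₂
  rw [← hy₁, ← LinearMap.comp_apply, ← LinearMap.lTensor_comp, htd, LinearMap.lTensor_zero,
    LinearMap.zero_apply]

end

/-- If `Tor₁(M, C) = 0`, then `M ⊗ -` preserves exactness of `0 → K → L → C → 0`. -/
theorem TorGrp.lTensor_injective {R : Type} [CommRing R] {M C K L : Type}
    [AddCommGroup M] [Module R M] [AddCommGroup C] [Module R C]
    [AddCommGroup K] [Module R K] [AddCommGroup L] [Module R L]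
    (htor : Subsingleton (TorGrp R 1 M C)) {f : K →ₗ[R] L} {g : L →ₗ[R] C}
    (hf : Function.Injective f) (hfg : Function.Exact f g) (hg : Function.Surjective g) :
    Function.Injective (f.lTensor M) := by
  let P := projectiveResolution (ModuleCat.of R C)
  let F := (MonoidalCategory.tensoringLeft (ModuleCat R)).obj (ModuleCat.of R M)
  have hzero : Limits.IsZero (((F.mapHomologicalComplex _).obj P.complex).homology 1) :=
    (ModuleCat.isZero_of_subsingleton (((Tor (ModuleCat R) 1).obj (ModuleCat.of R M)).obj
      (ModuleCat.of R C))).of_iso (P.isoLeftDerivedObj F 1).symm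
  have hM := (HomologicalComplex.exactAt_iff' _ 2 1 0 (by simp) (by simp)).1
    ((HomologicalComplex.exactAt_iff_isZero_homology _ _).2 hzero)
  rw [ShortComplex.ShortExact.moduleCat_exact_iff_function_exact] at hM
  have hex := P.exact₀
  rw [ShortComplex.ShortExact.moduleCat_exact_iff_function_exact] at hex
  have : Module.Projective R (P.complex.X 0) :=
    (IsProjective.iff_projective _).2 (P.projective 0)
  exact LinearMap.lTensor_injective_of_exact_resolution M
    (d₂ := (P.complex.d 2 1).hom) (d₁ := (P.complex.d 1 0).hom) (π := (P.π.f 0).hom)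
    (by rw [← ModuleCat.hom_comp, P.complex.d_comp_d, ModuleCat.hom_zero]) hex
    ((ModuleCat.epi_iff_surjective _).1 inferInstance) hM hf hfg hg

/-- If `𝔪S ≠ S` and `Tor₁(S, R/𝔪) = 0`, then `N → S ⊗ N` is injective for `N` of finite length. -/
theorem IsFiniteLength.mk_one_injective_of_tor {R : Type} [CommRing R] [IsLocalRing R]
    {S : Type} [CommRing S] [Algebra R S]
    (hS : (IsLocalRing.maximalIdeal R).map (algebraMap R S) ≠ ⊤)
    (htor : Subsingleton (TorGrp R 1 S (IsLocalRing.ResidueField R)))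
    {N : Type} [AddCommGroup N] [Module R N] (hN : IsFiniteLength R N) :
    Function.Injective (TensorProduct.mk R S N 1) := by
  induction hN with
  | of_subsingleton => exact Function.injective_of_subsingleton _
  | @of_simple_quotient N _ _ N' _ hN' ih =>
    obtain ⟨m, hm, ⟨e⟩⟩ := isSimpleModule_iff_quot_maximal.1 ‹IsSimpleModule R (N ⧸ N')›
    obtain rfl := IsLocalRing.eq_maximalIdeal hm
    let g : N →ₗ[R] IsLocalRing.ResidueField R := e.toLinearMap ∘ₗ N'.mkQ
    have hker (x : N) : g x = 0 ↔ x ∈ N' :=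
      e.map_eq_zero_iff.trans (Submodule.Quotient.mk_eq_zero N')
    have hinj := TorGrp.lTensor_injective htor N'.injective_subtype (g := g)
      (fun x ↦ by simp [hker]) (e.surjective.comp N'.mkQ_surjective)
    have hk : Function.Injective (TensorProduct.mk R S (IsLocalRing.ResidueField R) 1) := by
      have : Nontrivial (TensorProduct R S (IsLocalRing.ResidueField R)) := by
        have := Ideal.Quotient.nontrivial_iff.2 hS
        exact (Algebra.TensorProduct.quotIdealMapEquivTensorQuot S
          (IsLocalRing.maximalIdeal R)).symm.toEquiv.nontrivial
      exact (Algebra.TensorProduct.includeRight :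
        IsLocalRing.ResidueField R →ₐ[R] _).toRingHom.injective
    rw [injective_iff_map_eq_zero]
    intro x hx
    have hgx : g x = 0 := by
      apply (injective_iff_map_eq_zero _).1 hk
      simpa using congrArg (g.lTensor S) hx
    have hx' : x ∈ N' := (hker x).1 hgx
    have : TensorProduct.mk R S N' 1 ⟨x, hx'⟩ = 0 := by
      apply (injective_iff_map_eq_zero _).1 hinj
      simpa using hx
    exact congrArg Subtype.val ((injective_iff_map_eq_zero _).1 ih _ this)

theorem Ideal.iInf_sup_maximalIdeal_pow {R : Type*} [CommRing R] [IsNoetherianRing R]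
    [IsLocalRing R] (I : Ideal R) : ⨅ n : ℕ, I ⊔ IsLocalRing.maximalIdeal R ^ n = I := by
  refine le_antisymm (fun x hx ↦ ?_) (le_iInf fun n ↦ le_sup_left)
  have h := Ideal.iInf_pow_smul_eq_bot_of_isLocalRing (M := R ⧸ I) (IsLocalRing.maximalIdeal R)
    Ideal.IsPrime.ne_top'
  rw [← Ideal.Quotient.eq_zero_iff_mem, ← Submodule.mem_bot R, ← h, Submodule.mem_iInf]
  intro n
  obtain ⟨a, ha, b, hb, rfl⟩ := Submodule.mem_sup.1 ((Submodule.mem_iInf _).1 hx n)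
  rw [map_add, Ideal.Quotient.eq_zero_iff_mem.2 ha, zero_add]
  have := Submodule.smul_mem_smul hb (Submodule.mem_top (x := (1 : R ⧸ I)) (R := R))
  rwa [Algebra.smul_def, mul_one] at this

theorem IsLocalRing.isFiniteLength_quotient_of_pow_le {R : Type*} [CommRing R] [IsNoetherianRing R]
    [IsLocalRing R] {I : Ideal R} {n : ℕ} (h : IsLocalRing.maximalIdeal R ^ n ≤ I) :
    IsFiniteLength R (R ⧸ I) := by
  by_cases hI : I = ⊤
  · subst hI
    exact .of_subsingleton
  have := Ideal.Quotient.nontrivial_iff.2 hI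
  have : IsLocalRing (R ⧸ I) := .of_surjective' (Ideal.Quotient.mk I) Ideal.Quotient.mk_surjective
  have hm : maximalIdeal (R ⧸ I) ≤ (maximalIdeal R).map (Ideal.Quotient.mk I) := by
    intro x hx
    obtain ⟨r, rfl⟩ := Ideal.Quotient.mk_surjective x
    exact Ideal.mem_map_of_mem _ fun hr ↦ hx (hr.map _)
  have : IsArtinianRing (R ⧸ I) := by
    rw [isArtinianRing_iff_isNilpotent_maximalIdeal]
    refine ⟨n, ?_⟩
    rw [Ideal.zero_eq_bot, ← le_bot_iff]
    refine (Ideal.pow_right_mono hm n).trans (le_of_eq ?_)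
    rwa [← Ideal.map_pow, Ideal.map_eq_bot_iff_le_ker, Ideal.mk_ker]
  rw [isFiniteLength_iff_isNoetherian_isArtinian]
  exact ⟨inferInstance, isArtinian_of_surjective_algebraMap (S := R) (R := R ⧸ I) (M := R ⧸ I)
    Ideal.Quotient.mk_surjective⟩

open scoped TensorProduct in
theorem Ideal.comap_map_eq_of_subsingleton_tor {R : Type} [CommRing R] [IsNoetherianRing R]
    [IsLocalRing R] {S : Type} [CommRing S] [Algebra R S]
    (hS : (IsLocalRing.maximalIdeal R).map (algebraMap R S) ≠ ⊤)
    (htor : Subsingleton (TorGrp R 1 S (IsLocalRing.ResidueField R))) (I : Ideal R) :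
    (I.map (algebraMap R S)).comap (algebraMap R S) = I := by
  refine le_antisymm (fun x hx ↦ ?_) Ideal.le_comap_map
  rw [← I.iInf_sup_maximalIdeal_pow, Submodule.mem_iInf]
  intro n
  have hJ := IsFiniteLength.mk_one_injective_of_tor hS htor
    (IsLocalRing.isFiniteLength_quotient_of_pow_le
      (le_sup_right (a := I) (b := IsLocalRing.maximalIdeal R ^ n)))
  replace hx := Ideal.map_mono (f := algebraMap R S)
    (le_sup_left (a := I) (b := IsLocalRing.maximalIdeal R ^ n)) hx
  generalize I ⊔ IsLocalRing.maximalIdeal R ^ n = J at hJ hx ⊢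
  rw [← Ideal.Quotient.eq_zero_iff_mem]
  apply (injective_iff_map_eq_zero _).1 hJ
  have h1 : (1 : S) ⊗ₜ[R] Ideal.Quotient.mk J x = algebraMap R S x ⊗ₜ[R] (1 : R ⧸ J) := by
    rw [← mul_one (Ideal.Quotient.mk J x), ← Ideal.Quotient.algebraMap_eq, ← Algebra.smul_def,
      TensorProduct.tmul_smul, TensorProduct.smul_tmul', Algebra.smul_def, mul_one]
  rw [TensorProduct.mk_apply, h1, ← Algebra.TensorProduct.quotIdealMapEquivTensorQuot_mk,
    Ideal.Quotient.eq_zero_iff_mem.2 hx, map_zero]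

/-- If `(R, 𝔪)` is an excellent local domain of prime characteristic `p` with
`Tor_1^R(R⁺, k) = 0`, then every ideal of `R` is plus-closed: `IR⁺ ∩ R = I`. -/
theorem ideals_plus_closed_of_tor_one_vanishing
    (R : Type) [CommRing R] [IsDomain R] [IsNoetherianRing R] [IsLocalRing R]
    (hExc : IsExcellentRing R)
    (p : ℕ) (hp : p.Prime) [CharP R p]
    (htor : Subsingleton (TorGrp R 1 (AbsIntClo R) (IsLocalRing.ResidueField R))) :
    ∀ I : Ideal R,
      Ideal.comap (algebraMap R (AbsIntClo R))
        (Ideal.map (algebraMap R (AbsIntClo R)) I) = I := by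
  intro I
  have : FaithfulSMul R (AlgebraicClosure (FractionRing R)) :=
    FaithfulSMul.trans R (FractionRing R) _
  refine Ideal.comap_map_eq_of_subsingleton_tor (fun h ↦ ?_) htor I
  obtain ⟨Q, hQ, hQm⟩ := Ideal.exists_ideal_over_maximal_of_isIntegral (S := AbsIntClo R)
    (IsLocalRing.maximalIdeal R) (by
      rw [(RingHom.injective_iff_ker_eq_bot _).1 (FaithfulSMul.algebraMap_injective R (AbsIntClo R))]
      exact bot_le)
  exact hQ.ne_top (top_le_iff.1 (h ▸ Ideal.map_le_iff_le_comap.2 hQm.ge))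
end
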